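/- arXiv:1612.01819 — 4 statements merged into one kernel-verified Lean document; each statement's English description precedes it below -/
import Mathlib

section
/- Let a > b > 0 and a < r < a²/b. Then the area of the set {x ∈ ℝ² : (sphere(x,r) ∩ C(a,b)) has cardinality 4} equals F(β) − A*, where A* = πr² + πab − 4raE(ε), F(φ) = 2r²φ + 2ab·arctan((b/a)tanφ) − 4ra·E(φ,ε) + raε² sin(2φ)/√(1−ε² sin²φ), and β = arctan( a√(r² − a²) / √(a⁴ − r²b²) ). -/
open Real MeasureTheory Set Metric

noncomputable section

/-- The Euclidean plane. -/
abbrev E2 := EuclideanSpace ℝ (Fin 2)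

/-- Closed elliptical region with semi-axes `a`, `b`. -/
def Kset (a b : ℝ) : Set E2 := {x | (x 0)^2 / a^2 + (x 1)^2 / b^2 ≤ 1}

/-- The ellipse with semi-axes `a`, `b`. -/
def Cset (a b : ℝ) : Set E2 := {x | (x 0)^2 / a^2 + (x 1)^2 / b^2 = 1}

/-- Incomplete elliptic integral of the second kind `E(φ, ε)`. -/
def Einc (ε φ : ℝ) : ℝ := ∫ θ in (0:ℝ)..φ, Real.sqrt (1 - ε^2 * Real.sin θ^2)

/-- Complete elliptic integral of the second kind `E(ε)`. -/
def Ecomp (ε : ℝ) : ℝ := Einc ε (π/2)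

/-- Eccentricity of the ellipse with semi-axes `a ≥ b`. -/
def ecc (a b : ℝ) : ℝ := Real.sqrt (a^2 - b^2) / a
/-- The antiderivative `F(φ)` from the paper's Lemma 1. -/
def Ffun (a b r φ : ℝ) : ℝ :=
  2*r^2*φ + 2*a*b*Real.arctan ((b/a)*Real.tan φ) - 4*r*a*Einc (ecc a b) φ
    + r*a*(ecc a b)^2 * Real.sin (2*φ) / Real.sqrt (1 - (ecc a b)^2 * Real.sin φ^2)
/-- The quantity `A* = πr² + πab − 4raE(ε)`. -/
def Astar (a b r : ℝ) : ℝ := π*r^2 + π*a*b - 4*r*a*Ecomp (ecc a b)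
/-- The angle `β` from Case 4 of the paper's Lemma 1. -/
def betaAng (a b r : ℝ) : ℝ :=
  Real.arctan (a * Real.sqrt (r^2 - a^2) / Real.sqrt (a^4 - r^2*b^2))

/-- The power of the point `(a cos t, b sin t)` with respect to the circle of radius `r`
centered at `(u, y)`. -/
def circlePower (a b r u y t : ℝ) : ℝ :=
  (a * cos t - u) ^ 2 + (b * sin t - y) ^ 2 - r ^ 2

lemma injOn_ellipse_param {a b : ℝ} (ha : 0 < a) (hb : 0 < b) (α : ℝ) :
    InjOn (fun t => (!₂[a * cos t, b * sin t] : E2)) (Ico α (α + 2 * π)) := by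
  intro s hs t ht hst
  have h0 : a * cos s = a * cos t := by simpa using congrArg (fun p : E2 => p 0) hst
  have h1 : b * sin s = b * sin t := by simpa using congrArg (fun p : E2 => p 1) hst
  have hc := mul_left_cancel₀ ha.ne' h0
  have hsn := mul_left_cancel₀ hb.ne' h1
  have hang := Real.Angle.cos_sin_inj hc hsn
  have h2 := (toIcoMod_eq_self Real.two_pi_pos).2 hs
  have h3 := (toIcoMod_eq_self Real.two_pi_pos).2 ht
  rw [← h2, ← h3]
  obtain ⟨k, hk⟩ := Real.Angle.angle_eq_iff_two_pi_dvd_sub.1 hang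
  have : s = t + k • (2 * π) := by simp; linarith
  rw [this, toIcoMod_add_zsmul]

lemma exists_ellipse_param {a b : ℝ} (ha : 0 < a) (hb : 0 < b) (α : ℝ) {p : E2}
    (hp : p ∈ Cset a b) :
    ∃ t ∈ Ico α (α + 2 * π), (!₂[a * cos t, b * sin t] : E2) = p := by
  have hp' : (p 0 / a) ^ 2 + (p 1 / b) ^ 2 = 1 := by
    simpa [Cset, div_pow] using hp
  let z : ℂ := ⟨p 0 / a, p 1 / b⟩
  have hz : ‖z‖ = 1 := by
    rw [Complex.norm_def, Complex.normSq_mk]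
    rw [show p 0 / a * (p 0 / a) + p 1 / b * (p 1 / b) = 1 by linarith]
    simp
  have hz0 : z ≠ 0 := by
    intro h; simp [h] at hz
  refine ⟨toIcoMod Real.two_pi_pos α z.arg, toIcoMod_mem_Ico _ _ _, ?_⟩
  have hk : toIcoMod Real.two_pi_pos α z.arg
      = z.arg - (toIcoDiv Real.two_pi_pos α z.arg : ℤ) * (2 * π) := by
    rw [toIcoMod, zsmul_eq_mul]
  rw [hk, Real.cos_sub_int_mul_two_pi, Real.sin_sub_int_mul_two_pi, Complex.cos_arg hz0,
    Complex.sin_arg, hz]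
  ext i
  fin_cases i
  · simp [z]; field_simp
  · simp [z]; field_simp

lemma ncard_sphere_inter_Cset {a b r : ℝ} (ha : 0 < a) (hb : 0 < b) (hr : 0 < r) (x : E2)
    (α : ℝ) : (sphere x r ∩ Cset a b).ncard =
      {t ∈ Ico α (α + 2 * π) | circlePower a b r (x 0) (x 1) t = 0}.ncard := by
  rw [← ((injOn_ellipse_param ha hb α).mono (sep_subset _ _)).ncard_image]
  congr 1
  ext p
  have key : ∀ t, (!₂[a * cos t, b * sin t] : E2) ∈ sphere x r ↔
      circlePower a b r (x 0) (x 1) t = 0 := by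
    intro t
    rw [mem_sphere, EuclideanSpace.dist_eq, Real.sqrt_eq_iff_eq_sq (by positivity) hr.le]
    simp [Real.dist_eq, sq_abs, circlePower, sub_eq_zero]
  constructor
  · rintro ⟨hp, hC⟩
    obtain ⟨t, ht, rfl⟩ := exists_ellipse_param ha hb α hC
    exact ⟨t, ⟨ht, (key t).1 hp⟩, rfl⟩
  · rintro ⟨t, ⟨ht, hD⟩, rfl⟩
    refine ⟨(key t).2 hD, ?_⟩
    simp only [Cset, mem_ofPred_eq]
    simp only [Matrix.cons_val_zero, Matrix.cons_val_one]
    field_simp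
    exact Real.cos_sq_add_sin_sq t

open Polynomial in
lemma finite_zeros_circlePower {a b r : ℝ} (hb : 0 < b) (hba : b < a) (u y α : ℝ) :
    {t ∈ Ico α (α + 2 * π) | circlePower a b r u y t = 0}.Finite ∧
    {t ∈ Ico α (α + 2 * π) | circlePower a b r u y t = 0}.ncard ≤ 4 := by
  set Z := {t ∈ Ico α (α + 2 * π) | circlePower a b r u y t = 0}
  let P : ℂ[X] := C (((a ^ 2 - b ^ 2) / 4 : ℝ) : ℂ) * X ^ 4
    + C (-(a * u : ℝ) + Complex.I * (b * y : ℝ)) * X ^ 3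
    + C ((u ^ 2 + y ^ 2 - r ^ 2 + (a ^ 2 + b ^ 2) / 2 : ℝ) : ℂ) * X ^ 2
    + C (-(a * u : ℝ) - Complex.I * (b * y : ℝ)) * X
    + C (((a ^ 2 - b ^ 2) / 4 : ℝ) : ℂ)
  have hdeg : P.natDegree ≤ 4 := by unfold P; compute_degree
  have hc4 : P.coeff 4 = (((a ^ 2 - b ^ 2) / 4 : ℝ) : ℂ) := by
    simp only [P, coeff_add, coeff_C_mul, coeff_X_pow, coeff_X, coeff_C]
    norm_num
  have hP : P ≠ 0 := by
    intro h
    rw [h, coeff_zero] at hc4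
    have : (a ^ 2 - b ^ 2) / 4 = 0 := by exact_mod_cast hc4.symm
    nlinarith
  let f : ℝ → ℂ := fun t => ⟨cos t, sin t⟩
  have hf : InjOn f Z := by
    intro s hs t ht hst
    refine injOn_ellipse_param one_pos one_pos α hs.1 ht.1 ?_
    have h1 := congrArg Complex.re hst
    have h2 := congrArg Complex.im hst
    simp only [f] at h1 h2
    simp [h1, h2]
  have hmap : f '' Z ⊆ (P.roots.toFinset : Set ℂ) := by
    rintro _ ⟨t, ⟨-, ht⟩, rfl⟩
    simp only [Finset.mem_coe, Multiset.mem_toFinset]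
    rw [mem_roots hP, IsRoot.def]
    have hs := Real.sin_sq_add_cos_sq t
    have hz : (f t) = cos t + Complex.I * sin t := by
      apply Complex.ext <;> simp [f, -Complex.ofReal_cos, -Complex.ofReal_sin]
    have ht' : ((circlePower a b r u y t : ℝ) : ℂ) = 0 := by rw [ht]; simp
    have hs' : ((sin t : ℝ) : ℂ) ^ 2 + ((cos t : ℝ) : ℂ) ^ 2 = 1 := by exact_mod_cast hs
    have hev : P.eval (f t) = (f t) ^ 2 * ((circlePower a b r u y t : ℝ) : ℂ) := by
      rw [hz]
      simp only [P, circlePower, eval_add, eval_mul, eval_C, eval_pow, eval_X, Complex.ofReal_add,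
        Complex.ofReal_sub, Complex.ofReal_mul, Complex.ofReal_pow, Complex.ofReal_div,
        Complex.ofReal_ofNat]
      generalize ((sin t : ℝ) : ℂ) = s at *
      generalize ((cos t : ℝ) : ℂ) = c at *
      have hI : Complex.I ^ 2 = -1 := Complex.I_sq
      linear_combination (c + Complex.I * s) ^ 2 *
        ((((a : ℂ) ^ 2 - b ^ 2) / 2 * s ^ 2 + 2 * b * y * s) * hI
          - ((a : ℂ) ^ 2 + b ^ 2) / 2 * hs')
        - (((a : ℂ) ^ 2 - b ^ 2) / 4 * (1 + (c + Complex.I * s) * (c - Complex.I * s))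
          + (-(a * u) - Complex.I * (b * y)) * (c + Complex.I * s)) * (hs' - s ^ 2 * hI)
    rw [hev, ht', mul_zero]
  have hfin : (f '' Z).Finite := (Finset.finite_toSet _).subset hmap
  refine ⟨hfin.of_finite_image hf, ?_⟩
  rw [← hf.ncard_image]
  calc (f '' Z).ncard ≤ (P.roots.toFinset : Set ℂ).ncard :=
        ncard_le_ncard hmap (Finset.finite_toSet _)
    _ = P.roots.toFinset.card := ncard_coe_finset _
    _ ≤ P.roots.card := Multiset.toFinset_card_le _
    _ ≤ P.natDegree := card_roots' P
    _ ≤ 4 := hdeg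
lemma exists_sign_change {A B : ℝ} (K : ℝ) (hA : 0 < A) (hB : 0 < B) :
    ∃ μ ∈ Ioo 0 (π / 2), K * sin μ * cos μ + A * sin μ - B * cos μ = 0 ∧
      (∀ t ∈ Ioo 0 μ, K * sin t * cos t + A * sin t - B * cos t < 0) ∧
      ∀ t ∈ Ioo μ (π / 2), 0 < K * sin t * cos t + A * sin t - B * cos t := by
  have hpi := Real.pi_pos
  have hcont : ContinuousOn (fun t => K * sin t * cos t + A * sin t - B * cos t)
      (Icc 0 (π / 2)) := by fun_prop
  obtain ⟨μ, hμ, hμ0⟩ := intermediate_value_Ioo (by positivity) hcont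
    (show (0 : ℝ) ∈ Ioo _ _ by simp [hA, hB])
  have hsμ := sin_pos_of_pos_of_lt_pi hμ.1 (by linarith [hμ.2])
  have hcμ := cos_pos_of_mem_Ioo ⟨by linarith [hμ.1], hμ.2⟩
  have key : ∀ t, (K * sin t * cos t + A * sin t - B * cos t) * (sin μ * cos μ) =
      A * sin t * sin μ * (cos μ - cos t) + B * cos t * cos μ * (sin t - sin μ) := by
    intro t
    simp only at hμ0
    linear_combination (sin t * cos t) * hμ0
  refine ⟨μ, hμ, hμ0, fun t ht => ?_, fun t ht => ?_⟩
  · have hs := sin_pos_of_pos_of_lt_pi ht.1 (by linarith [hμ.2, ht.2])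
    have hc := cos_pos_of_mem_Ioo ⟨by linarith [ht.1], ht.2.trans hμ.2⟩
    have h1 := cos_lt_cos_of_nonneg_of_le_pi_div_two ht.1.le hμ.2.le ht.2
    have h2 := sin_lt_sin_of_lt_of_le_pi_div_two (by linarith [ht.1]) hμ.2.le ht.2
    refine neg_of_mul_neg_left ?_ (mul_pos hsμ hcμ).le
    rw [key]
    have h3 := mul_pos (mul_pos (mul_pos hA hs) hsμ) (sub_pos.2 h1)
    have h4 := mul_pos (mul_pos (mul_pos hB hc) hcμ) (sub_pos.2 h2)
    linarith
  · have hs := sin_pos_of_pos_of_lt_pi (hμ.1.trans ht.1) (by linarith [ht.2])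
    have hc := cos_pos_of_mem_Ioo ⟨by linarith [hμ.1, ht.1], ht.2⟩
    have h1 := cos_lt_cos_of_nonneg_of_le_pi_div_two hμ.1.le ht.2.le ht.1
    have h2 := sin_lt_sin_of_lt_of_le_pi_div_two (by linarith [hμ.1]) ht.2.le ht.1
    refine pos_of_mul_pos_left ?_ (mul_pos hsμ hcμ).le
    rw [key]
    exact add_pos (mul_pos (mul_pos (mul_pos hA hs) hsμ) (sub_pos.2 h1))
      (mul_pos (mul_pos (mul_pos hB hc) hcμ) (sub_pos.2 h2))

/-- Half the derivative of `circlePower`. -/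
def circlePowerSlope (a b u y t : ℝ) : ℝ :=
  -(a ^ 2 - b ^ 2) * sin t * cos t + a * u * sin t - b * y * cos t

lemma hasDerivAt_circlePower (a b r u y t : ℝ) :
    HasDerivAt (circlePower a b r u y) (2 * circlePowerSlope a b u y t) t := by
  have h1 := (((Real.hasDerivAt_cos t).const_mul a).sub_const u).pow 2
  have h2 := (((Real.hasDerivAt_sin t).const_mul b).sub_const y).pow 2
  exact ((h1.add h2).sub_const (r ^ 2)).congr_deriv (by simp [circlePowerSlope]; ring)

lemma continuous_circlePower (a b r u y : ℝ) : Continuous (circlePower a b r u y) := by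
  unfold circlePower; fun_prop

lemma strictMonoOn_circlePower {a b r u y l m : ℝ}
    (h : ∀ t ∈ Ioo l m, 0 < circlePowerSlope a b u y t) :
    StrictMonoOn (circlePower a b r u y) (Icc l m) := by
  refine strictMonoOn_of_deriv_pos (convex_Icc _ _)
    (continuous_circlePower ..).continuousOn fun t ht => ?_
  rw [interior_Icc] at ht
  rw [(hasDerivAt_circlePower ..).deriv]
  linarith [h t ht]

lemma slope_pos_between {a b u y w₁ z w₂ : ℝ} (ha : 0 < a) (hb : 0 < b) (hu : 0 < u) (hy : 0 < y)
    (hw₁ : -(π / 2) < w₁) (h₁ : w₁ < z) (h₂ : z < w₂) (hw₂ : w₂ < 0)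
    (hq₁ : circlePowerSlope a b u y w₁ = 0) (hq₂ : circlePowerSlope a b u y w₂ = 0) :
    0 < circlePowerSlope a b u y z := by
  have hA : 0 < a * u := mul_pos ha hu
  have hB : 0 < b * y := mul_pos hb hy
  have hcos : ∀ t, w₁ ≤ t → t ≤ w₂ → 0 < cos t := fun t h h' =>
    cos_pos_of_mem_Ioo ⟨by linarith, by linarith [Real.pi_pos]⟩
  have hsin : ∀ t, w₁ ≤ t → t ≤ w₂ → sin t < 0 := fun t h h' =>
    sin_neg_of_neg_of_neg_pi_lt (by linarith) (by linarith [Real.pi_pos])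
  let f : ℝ → ℝ := fun t => a * u / cos t - b * y / sin t
  let f' : ℝ → ℝ := fun t => a * u * (sin t / cos t ^ 2) + b * y * (cos t / sin t ^ 2)
  have hf : ∀ t, w₁ ≤ t → t ≤ w₂ → HasDerivAt f (f' t) t := by
    intro t h h'
    have h1 := (Real.hasDerivAt_cos t).inv (hcos t h h').ne'
    have h2 := (Real.hasDerivAt_sin t).inv (hsin t h h').ne
    exact ((h1.const_mul (a * u)).sub (h2.const_mul (b * y))).congr_deriv
      (by simp only [f']; ring)
  have hq : ∀ t, w₁ ≤ t → t ≤ w₂ →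
      circlePowerSlope a b u y t = sin t * cos t * (f t - (a ^ 2 - b ^ 2)) := by
    intro t h h'
    have := (hcos t h h').ne'
    have := (hsin t h h').ne
    simp only [circlePowerSlope, f]
    field_simp
    ring
  have hval : ∀ t, w₁ ≤ t → t ≤ w₂ → circlePowerSlope a b u y t = 0 →
      f t = a ^ 2 - b ^ 2 := by
    intro t h h' h0
    rw [hq t h h'] at h0
    have := (mul_neg_of_neg_of_pos (hsin t h h') (hcos t h h')).ne
    rcases mul_eq_zero.1 h0 with h | h
    · exact absurd h this
    · linarith
  have e₁ := hval w₁ le_rfl (by linarith) hq₁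
  have e₂ := hval w₂ (by linarith) le_rfl hq₂
  have hcontf : ∀ l m, w₁ ≤ l → m ≤ w₂ → ContinuousOn f (Icc l m) := fun l m hl hm t ht =>
    (hf t (hl.trans ht.1) (ht.2.trans hm)).continuousAt.continuousWithinAt
  obtain ⟨ξ₁, hξ₁, hs₁⟩ := exists_hasDerivAt_eq_slope f f' h₁ (hcontf _ _ le_rfl h₂.le)
    fun t ht => hf t ht.1.le (by linarith [ht.2])
  obtain ⟨ξ₂, hξ₂, hs₂⟩ := exists_hasDerivAt_eq_slope f f' h₂ (hcontf _ _ h₁.le le_rfl)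
    fun t ht => hf t (by linarith [ht.1]) ht.2.le
  have hlt : ξ₁ < ξ₂ := hξ₁.2.trans hξ₂.1
  have hmono : f' ξ₁ < f' ξ₂ := by
    have hc1 := hcos ξ₁ hξ₁.1.le (by linarith [hξ₁.2])
    have hc2 := hcos ξ₂ (by linarith [hξ₂.1]) hξ₂.2.le
    have hs1 := hsin ξ₁ hξ₁.1.le (by linarith [hξ₁.2])
    have hs2 := hsin ξ₂ (by linarith [hξ₂.1]) hξ₂.2.le
    have hcc : cos ξ₁ < cos ξ₂ := by
      rw [← cos_neg ξ₁, ← cos_neg ξ₂]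
      exact cos_lt_cos_of_nonneg_of_le_pi_div_two (by linarith [hξ₂.2]) (by linarith [hξ₁.1])
        (by linarith)
    have hss : sin ξ₁ < sin ξ₂ :=
      sin_lt_sin_of_lt_of_le_pi_div_two (by linarith [hξ₁.1]) (by linarith [hξ₂.2]) hlt
    have i1 : sin ξ₁ / cos ξ₁ ^ 2 < sin ξ₂ / cos ξ₂ ^ 2 := by
      have : -sin ξ₂ / cos ξ₂ ^ 2 < -sin ξ₁ / cos ξ₁ ^ 2 :=
        div_lt_div₀ (by linarith) (pow_le_pow_left₀ hc1.le hcc.le 2) (by linarith) (by positivity)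
      rw [neg_div, neg_div] at this
      linarith
    have i2 : cos ξ₁ / sin ξ₁ ^ 2 < cos ξ₂ / sin ξ₂ ^ 2 := by
      refine div_lt_div₀ hcc (by nlinarith) hc2.le (sq_pos_of_neg hs2)
    simp only [f']
    gcongr
  rw [hq z h₁.le h₂.le]
  refine mul_pos_of_neg_of_neg (mul_neg_of_neg_of_pos (hsin z h₁.le h₂.le) (hcos z h₁.le h₂.le)) ?_
  by_contra! hz
  rw [e₁] at hs₁
  rw [e₂] at hs₂
  have k1 : 0 ≤ f' ξ₁ := by rw [hs₁]; exact div_nonneg (by linarith) (by linarith)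
  have k2 : f' ξ₂ ≤ 0 := by rw [hs₂]; exact div_nonpos_of_nonpos_of_nonneg (by linarith) (by linarith)
  linarith

lemma exists_lt_lt_of_three_le_ncard {s : Set ℝ} (hs : 3 ≤ s.ncard) :
    ∃ x ∈ s, ∃ y ∈ s, ∃ z ∈ s, x < y ∧ y < z := by
  have hfin : s.Finite := finite_of_ncard_pos (by omega)
  obtain ⟨t, hts, ht⟩ := Finset.exists_subset_card_eq
    (show 3 ≤ hfin.toFinset.card by rwa [← ncard_eq_toFinset_card s hfin])
  let f := t.orderEmbOfFin ht
  have hf : ∀ i, f i ∈ s := fun i =>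
    hfin.mem_toFinset.1 (hts (t.orderEmbOfFin_mem ht i))
  exact ⟨f 0, hf 0, f 1, hf 1, f 2, hf 2, f.lt_iff_lt.2 (by decide), f.lt_iff_lt.2 (by decide)⟩

lemma exists_neg_pos_of_ncard_eq_four {a b r u y : ℝ} (hb : 0 < b) (hba : b < a)
    (hu : 0 < u) (hy : 0 < y)
    (h : ∀ α, {t ∈ Ico α (α + 2 * π) | circlePower a b r u y t = 0}.ncard = 4) :
    ∃ t₁ t₂, -(π / 2) < t₁ ∧ t₁ < t₂ ∧ t₂ < 0 ∧ circlePower a b r u y t₁ < 0 ∧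
      0 < circlePower a b r u y t₂ := by
  have hpi := Real.pi_pos
  have ha : 0 < a := hb.trans hba
  have hA : 0 < a * u := mul_pos ha hu
  have hB : 0 < b * y := mul_pos hb hy
  obtain ⟨μ, hμ, hμ0, hμn, hμp⟩ := exists_sign_change (-(a ^ 2 - b ^ 2)) hA hB
  obtain ⟨ν, hν, hν0, hνn, hνp⟩ := exists_sign_change (a ^ 2 - b ^ 2) hA hB
  have hshift : ∀ t, circlePowerSlope a b u y (t - π) =
      -((a ^ 2 - b ^ 2) * sin t * cos t + a * u * sin t - b * y * cos t) := by
    intro t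
    simp only [circlePowerSlope, Real.sin_sub_pi, Real.cos_sub_pi]
    ring
  have hshift' : ∀ t, circlePowerSlope a b u y (t + π) =
      -((a ^ 2 - b ^ 2) * sin t * cos t + a * u * sin t - b * y * cos t) := by
    intro t
    simp only [circlePowerSlope, Real.sin_add_pi, Real.cos_add_pi]
    ring
  obtain ⟨hμ1, hμ2⟩ := hμ
  obtain ⟨hν1, hν2⟩ := hν
  have hinc : StrictMonoOn (circlePower a b r u y) (Icc μ (ν - π + 2 * π)) := by
    refine strictMonoOn_circlePower fun t ht => ?_
    obtain ⟨h1, h2⟩ := ht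
    rcases lt_or_ge t (π / 2) with h3 | h3
    · exact hμp t ⟨h1, h3⟩
    rcases le_or_gt t π with h4 | h4
    · have hc := cos_nonpos_of_pi_div_two_le_of_le h3 (by linarith)
      rcases h4.eq_or_lt with rfl | h4
      · simp [circlePowerSlope, hB]
      have hs := sin_pos_of_pos_of_lt_pi (by linarith) h4
      have k1 := mul_pos hA hs
      unfold circlePowerSlope
      nlinarith [mul_nonneg (mul_nonneg (by nlinarith : 0 ≤ a ^ 2 - b ^ 2) hs.le) (neg_nonneg.2 hc),
        mul_nonneg hB.le (neg_nonneg.2 hc)]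
    · have := hνn (t - π) ⟨by linarith, by linarith⟩
      have h5 := hshift' (t - π)
      rw [sub_add_cancel] at h5
      linarith
  have hQ4 : ∀ w ∈ Ioo (ν - π) μ, circlePowerSlope a b u y w = 0 → -(π / 2) < w ∧ w < 0 := by
    intro w hw hw0
    constructor
    · by_contra! hle
      rcases hle.eq_or_lt with rfl | hlt
      · simp [circlePowerSlope] at hw0
        rcases hw0 with h | h <;> linarith
      · have := hνp (w + π) ⟨by linarith [hw.1], by linarith⟩
        have h5 := hshift (w + π)
        rw [add_sub_cancel_right] at h5
        linarith
    · by_contra! hle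
      rcases hle.eq_or_lt with rfl | hlt
      · simp [circlePowerSlope] at hw0
        rcases hw0 with h | h <;> linarith
      · have := hμn w ⟨hlt, hw.2⟩
        unfold circlePowerSlope at hw0
        linarith
  have hcard : 3 ≤ {t ∈ Ico (ν - π) μ | circlePower a b r u y t = 0}.ncard := by
    have h4 := h (ν - π)
    have hsub : {t ∈ Ico (ν - π) (ν - π + 2 * π) | circlePower a b r u y t = 0} ⊆
        {t ∈ Ico (ν - π) μ | circlePower a b r u y t = 0} ∪
        {t ∈ Ico μ (ν - π + 2 * π) | circlePower a b r u y t = 0} := by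
      rintro t ⟨⟨h1, h2⟩, h3⟩
      rcases lt_or_ge t μ with h | h
      · exact Or.inl ⟨⟨h1, h⟩, h3⟩
      · exact Or.inr ⟨⟨h, h2⟩, h3⟩
    have hone : {t ∈ Ico μ (ν - π + 2 * π) | circlePower a b r u y t = 0}.Subsingleton := by
      rintro s ⟨hs, hs0⟩ t ⟨ht, ht0⟩
      exact hinc.injOn (Ico_subset_Icc_self hs) (Ico_subset_Icc_self ht) (hs0.trans ht0.symm)
    have hfin := finite_of_ncard_pos (h4 ▸ four_pos)
    have hfin' : {t ∈ Ico (ν - π) μ | circlePower a b r u y t = 0}.Finite :=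
      hfin.subset fun t ht => ⟨⟨ht.1.1, by linarith [ht.1.2]⟩, ht.2⟩
    have k1 := ncard_le_ncard hsub (hfin'.union hone.finite)
    have k2 := ncard_union_le {t ∈ Ico (ν - π) μ | circlePower a b r u y t = 0}
        {t ∈ Ico μ (ν - π + 2 * π) | circlePower a b r u y t = 0}
    have := hone.finite.to_subtype
    have k3 := ncard_le_one_iff_subsingleton.2 hone
    omega
  obtain ⟨z₁, hz₁, z₂, hz₂, z₃, hz₃, h12, h23⟩ := exists_lt_lt_of_three_le_ncard hcard
  obtain ⟨w₁, hw₁, hq₁⟩ := exists_hasDerivAt_eq_zero h12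
    (continuous_circlePower a b r u y).continuousOn (hz₁.2.trans hz₂.2.symm)
    fun t _ => hasDerivAt_circlePower a b r u y t
  obtain ⟨w₂, hw₂, hq₂⟩ := exists_hasDerivAt_eq_zero h23
    (continuous_circlePower a b r u y).continuousOn (hz₂.2.trans hz₃.2.symm)
    fun t _ => hasDerivAt_circlePower a b r u y t
  have hq₁ : circlePowerSlope a b u y w₁ = 0 := by linarith
  have hq₂ : circlePowerSlope a b u y w₂ = 0 := by linarith
  have m₁ := hQ4 w₁ ⟨by linarith [hw₁.1, hz₁.1.1], by linarith [hw₁.2, hz₂.1.2]⟩ hq₁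
  have m₂ := hQ4 w₂ ⟨by linarith [hw₂.1, hz₂.1.1], by linarith [hw₂.2, hz₃.1.2]⟩ hq₂
  have hww : w₁ < w₂ := hw₁.2.trans hw₂.1
  have hmono : StrictMonoOn (circlePower a b r u y) (Icc w₁ w₂) :=
    strictMonoOn_circlePower fun t ht =>
      slope_pos_between ha hb hu hy m₁.1 ht.1 ht.2 m₂.2 hq₁ hq₂
  have hzm : z₂ ∈ Icc w₁ w₂ := ⟨hw₁.2.le, hw₂.1.le⟩
  refine ⟨w₁, w₂, m₁.1, hww, m₂.2, ?_, ?_⟩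
  · rw [← hz₂.2]; exact hmono (left_mem_Icc.2 hww.le) hzm hw₁.2
  · rw [← hz₂.2]; exact hmono hzm (right_mem_Icc.2 hww.le) hw₂.1

lemma ncard_eq_four_of_exists_neg_pos {a b r u y t₁ t₂ : ℝ} (hb : 0 < b) (hba : b < a)
    (hu : 0 < u) (hy : 0 < y) (h₁ : -(π / 2) < t₁) (h₁₂ : t₁ < t₂) (h₂ : t₂ < 0)
    (hD₁ : circlePower a b r u y t₁ < 0) (hD₂ : 0 < circlePower a b r u y t₂) :
    {t ∈ Ico (-π - t₂) (-π - t₂ + 2 * π) | circlePower a b r u y t = 0}.ncard = 4 := by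
  have hpi := Real.pi_pos
  have ha : 0 < a := hb.trans hba
  obtain ⟨hfin, hle⟩ := finite_zeros_circlePower (r := r) hb hba u y (-π - t₂)
  refine le_antisymm hle ?_
  have hcont : ∀ s : Set ℝ, ContinuousOn (circlePower a b r u y) s := fun s =>
    (continuous_circlePower a b r u y).continuousOn
  have hA : 0 < circlePower a b r u y (-π - t₂) := by
    have hc : 0 < cos t₂ := cos_pos_of_mem_Ioo ⟨by linarith, by linarith⟩
    have e : circlePower a b r u y (-π - t₂) =
        circlePower a b r u y t₂ + 4 * (a * u * cos t₂) := by
      have e1 : cos (-π - t₂) = - cos t₂ := by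
        rw [show -π - t₂ = -(t₂ + π) by ring, cos_neg, cos_add_pi]
      have e2 : sin (-π - t₂) = sin t₂ := by
        rw [show -π - t₂ = -(t₂ + π) by ring, sin_neg, sin_add_pi, neg_neg]
      simp only [circlePower, e1, e2]; ring
    rw [e]; positivity
  have hA' : 0 < circlePower a b r u y (π - t₂) := by
    rw [show π - t₂ = -π - t₂ + 2 * π by ring]
    simpa [circlePower] using hA
  have hB : circlePower a b r u y (-t₁) < 0 := by
    have hs : sin t₁ < 0 := sin_neg_of_neg_of_neg_pi_lt (by linarith) (by linarith)
    have e : circlePower a b r u y (-t₁) =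
        circlePower a b r u y t₁ + 4 * (b * y * sin t₁) := by
      simp only [circlePower, cos_neg, sin_neg]; ring
    have := mul_neg_of_pos_of_neg (mul_pos hb hy) hs
    linarith
  obtain ⟨x₁, hx₁, e₁⟩ := intermediate_value_Ioo' (by linarith : -π - t₂ ≤ t₁) (hcont _)
    (show (0 : ℝ) ∈ Ioo _ _ from ⟨hD₁, hA⟩)
  obtain ⟨x₂, hx₂, e₂⟩ := intermediate_value_Ioo h₁₂.le (hcont _)
    (show (0 : ℝ) ∈ Ioo _ _ from ⟨hD₁, hD₂⟩)
  obtain ⟨x₃, hx₃, e₃⟩ := intermediate_value_Ioo' (by linarith : t₂ ≤ -t₁) (hcont _)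
    (show (0 : ℝ) ∈ Ioo _ _ from ⟨hB, hD₂⟩)
  obtain ⟨x₄, hx₄, e₄⟩ := intermediate_value_Ioo (by linarith : -t₁ ≤ π - t₂) (hcont _)
    (show (0 : ℝ) ∈ Ioo _ _ from ⟨hB, hA'⟩)
  simp only [mem_Ioo] at hx₁ hx₂ hx₃ hx₄
  have hsub : (({x₁, x₂, x₃, x₄} : Finset ℝ) : Set ℝ) ⊆
      {t ∈ Ico (-π - t₂) (-π - t₂ + 2 * π) | circlePower a b r u y t = 0} := by
    intro t ht
    simp only [Finset.coe_insert, Finset.coe_singleton, mem_insert_iff, mem_singleton_iff] at ht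
    rcases ht with rfl | rfl | rfl | rfl
    · exact ⟨⟨by linarith, by linarith⟩, e₁⟩
    · exact ⟨⟨by linarith, by linarith⟩, e₂⟩
    · exact ⟨⟨by linarith, by linarith⟩, e₃⟩
    · exact ⟨⟨by linarith, by linarith⟩, e₄⟩
  have := ncard_le_ncard hsub hfin
  rw [ncard_coe_finset] at this
  refine le_trans (le_of_eq ?_) this
  rw [Finset.card_insert_of_notMem, Finset.card_insert_of_notMem, Finset.card_insert_of_notMem,
    Finset.card_singleton]
  · simp; linarith
  · simp; constructor <;> linarith
  · simp; refine ⟨?_, ?_, ?_⟩ <;> linarith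
/-- Support function of the elliptical region with semi-axes `a`, `b`. -/
def supportFn (a b φ : ℝ) : ℝ := √(a ^ 2 * cos φ ^ 2 + b ^ 2 * sin φ ^ 2)

/-- First coordinate of the point of the ellipse with outer normal `(cos φ, sin φ)`. -/
def contactX (a b φ : ℝ) : ℝ := a ^ 2 * cos φ / supportFn a b φ

/-- Second coordinate of the point of the ellipse with outer normal `(cos φ, sin φ)`. -/
def contactY (a b φ : ℝ) : ℝ := b ^ 2 * sin φ / supportFn a b φ

/-- Radius of curvature of the ellipse at the point with outer normal `(cos φ, sin φ)`. -/
def curvatureRadius (a b φ : ℝ) : ℝ := a ^ 2 * b ^ 2 / supportFn a b φ ^ 3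

/-- First coordinate of the center of the circle of radius `r` that touches the ellipse from the
inner side at `(contactX a b φ, -contactY a b φ)`. -/
def parallelX (a b r φ : ℝ) : ℝ := contactX a b φ - r * cos φ

/-- Second coordinate of the center of the circle of radius `r` that touches the ellipse from the
inner side at `(contactX a b φ, -contactY a b φ)`. -/
def parallelY (a b r φ : ℝ) : ℝ := r * sin φ - contactY a b φ

/-- Height of the upper center on the line `x = u` of a circle of radius `r` passing through
`(contactX a b φ, -contactY a b φ)`. -/
def centerHeight (a b r u φ : ℝ) : ℝ := √(r ^ 2 - (contactX a b φ - u) ^ 2) - contactY a b φ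

section ContactPoints

variable {a b : ℝ}

lemma supportFn_arg_pos (ha : 0 < a) (hb : 0 < b) (φ : ℝ) :
    0 < a ^ 2 * cos φ ^ 2 + b ^ 2 * sin φ ^ 2 := by
  by_cases h : sin φ = 0
  · have : cos φ ^ 2 = 1 := by have := sin_sq_add_cos_sq φ; rw [h] at this; linarith
    rw [h, this]; positivity
  · positivity

lemma supportFn_pos (ha : 0 < a) (hb : 0 < b) (φ : ℝ) : 0 < supportFn a b φ :=
  Real.sqrt_pos.2 (supportFn_arg_pos ha hb φ)

lemma supportFn_sq (ha : 0 < a) (hb : 0 < b) (φ : ℝ) :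
    supportFn a b φ ^ 2 = a ^ 2 * cos φ ^ 2 + b ^ 2 * sin φ ^ 2 :=
  Real.sq_sqrt (supportFn_arg_pos ha hb φ).le

@[fun_prop]
lemma continuous_supportFn : Continuous (supportFn a b) := by
  unfold supportFn; fun_prop

lemma continuous_contactX (ha : 0 < a) (hb : 0 < b) : Continuous (contactX a b) :=
  (by fun_prop : Continuous fun φ => a ^ 2 * cos φ).div continuous_supportFn
    fun φ => (supportFn_pos ha hb φ).ne'

lemma continuous_contactY (ha : 0 < a) (hb : 0 < b) : Continuous (contactY a b) :=
  (by fun_prop : Continuous fun φ => b ^ 2 * sin φ).div continuous_supportFn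
    fun φ => (supportFn_pos ha hb φ).ne'

lemma continuous_curvatureRadius (ha : 0 < a) (hb : 0 < b) : Continuous (curvatureRadius a b) :=
  continuous_const.div (continuous_supportFn.pow 3) fun φ => (pow_pos (supportFn_pos ha hb φ) 3).ne'

lemma continuous_parallelX (ha : 0 < a) (hb : 0 < b) (r : ℝ) : Continuous (parallelX a b r) := by
  have := continuous_contactX ha hb
  unfold parallelX; fun_prop

lemma continuous_parallelY (ha : 0 < a) (hb : 0 < b) (r : ℝ) : Continuous (parallelY a b r) := by
  have := continuous_contactY ha hb
  unfold parallelY; fun_prop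

lemma continuous_centerHeight (ha : 0 < a) (hb : 0 < b) (r u : ℝ) :
    Continuous (centerHeight a b r u) := by
  have := continuous_contactX ha hb
  have := continuous_contactY ha hb
  unfold centerHeight; fun_prop

lemma sin_pos_of_mem {φ : ℝ} (h : φ ∈ Ioo 0 (π / 2)) : 0 < sin φ :=
  sin_pos_of_pos_of_lt_pi h.1 (by linarith [h.2, Real.pi_pos])

lemma cos_pos_of_mem {φ : ℝ} (h : φ ∈ Ioo 0 (π / 2)) : 0 < cos φ :=
  cos_pos_of_mem_Ioo ⟨by linarith [h.1, Real.pi_pos], h.2⟩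

lemma contactX_pos (ha : 0 < a) (hb : 0 < b) {φ : ℝ} (h : φ ∈ Ioo 0 (π / 2)) :
    0 < contactX a b φ :=
  div_pos (mul_pos (by positivity) (cos_pos_of_mem h)) (supportFn_pos ha hb φ)

lemma contactY_pos (ha : 0 < a) (hb : 0 < b) {φ : ℝ} (h : φ ∈ Ioo 0 (π / 2)) :
    0 < contactY a b φ :=
  div_pos (mul_pos (by positivity) (sin_pos_of_mem h)) (supportFn_pos ha hb φ)

lemma curvatureRadius_pos (ha : 0 < a) (hb : 0 < b) (φ : ℝ) : 0 < curvatureRadius a b φ :=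
  div_pos (by positivity) (pow_pos (supportFn_pos ha hb φ) 3)

lemma contactX_lt (ha : 0 < a) (hb : 0 < b) {φ : ℝ} (h : φ ∈ Ioo 0 (π / 2)) :
    contactX a b φ < a := by
  rw [contactX, div_lt_iff₀ (supportFn_pos ha hb φ), pow_two, mul_assoc]
  refine mul_lt_mul_of_pos_left (lt_of_pow_lt_pow_left₀ 2 (supportFn_pos ha hb φ).le ?_) ha
  rw [supportFn_sq ha hb]
  have := mul_pos (pow_pos hb 2) (pow_pos (sin_pos_of_mem h) 2)
  nlinarith

lemma hasDerivAt_supportFn (ha : 0 < a) (hb : 0 < b) (φ : ℝ) :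
    HasDerivAt (supportFn a b) (-(a ^ 2 - b ^ 2) * sin φ * cos φ / supportFn a b φ) φ := by
  have h1 := ((Real.hasDerivAt_cos φ).pow 2).const_mul (a ^ 2)
  have h2 := ((Real.hasDerivAt_sin φ).pow 2).const_mul (b ^ 2)
  refine ((h1.add h2).sqrt (supportFn_arg_pos ha hb φ).ne').congr_deriv ?_
  change _ / (2 * supportFn a b φ) = _
  have := (supportFn_pos ha hb φ).ne'
  field_simp
  simp
  ring

lemma hasDerivAt_contactX (ha : 0 < a) (hb : 0 < b) (φ : ℝ) :
    HasDerivAt (contactX a b) (-(curvatureRadius a b φ * sin φ)) φ := by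
  have hh := (supportFn_pos ha hb φ).ne'
  refine (((Real.hasDerivAt_cos φ).const_mul (a ^ 2)).div (hasDerivAt_supportFn ha hb φ)
    hh).congr_deriv ?_
  have hs := supportFn_sq ha hb φ
  have := sin_sq_add_cos_sq φ
  rw [curvatureRadius]
  field_simp
  linear_combination -sin φ * hs - b ^ 2 * sin φ * this

lemma hasDerivAt_contactY (ha : 0 < a) (hb : 0 < b) (φ : ℝ) :
    HasDerivAt (contactY a b) (curvatureRadius a b φ * cos φ) φ := by
  have hh := (supportFn_pos ha hb φ).ne'
  refine (((Real.hasDerivAt_sin φ).const_mul (b ^ 2)).div (hasDerivAt_supportFn ha hb φ)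
    hh).congr_deriv ?_
  have hs := supportFn_sq ha hb φ
  have := sin_sq_add_cos_sq φ
  rw [curvatureRadius]
  field_simp
  linear_combination cos φ * hs + a ^ 2 * cos φ * this

lemma hasDerivAt_parallelX (ha : 0 < a) (hb : 0 < b) (r φ : ℝ) :
    HasDerivAt (parallelX a b r) ((r - curvatureRadius a b φ) * sin φ) φ :=
  ((hasDerivAt_contactX ha hb φ).sub ((Real.hasDerivAt_cos φ).const_mul r)).congr_deriv (by ring)

lemma hasDerivAt_parallelY (ha : 0 < a) (hb : 0 < b) (r φ : ℝ) :
    HasDerivAt (parallelY a b r) ((r - curvatureRadius a b φ) * cos φ) φ :=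
  (((Real.hasDerivAt_sin φ).const_mul r).sub (hasDerivAt_contactY ha hb φ)).congr_deriv (by ring)

lemma contact_eq_param (ha : 0 < a) (hb : 0 < b) {φ t : ℝ} (hφ : φ ∈ Ioo 0 (π / 2))
    (ht : t ∈ Ioo (-(π / 2)) 0) (h : a * tan (-t) = b * tan φ) :
    a * cos t = contactX a b φ ∧ b * sin t = -contactY a b φ := by
  have hc := cos_pos_of_mem hφ
  have hs := sin_pos_of_mem hφ
  have ht' : -t ∈ Ioo 0 (π / 2) := ⟨by linarith [ht.2], by linarith [ht.1]⟩
  have hct := cos_pos_of_mem ht'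
  have hst := sin_pos_of_mem ht'
  have hh := supportFn_pos ha hb φ
  have hsq := supportFn_sq ha hb φ
  rw [cos_neg] at hct
  rw [tan_neg, tan_eq_sin_div_cos, tan_eq_sin_div_cos] at h
  rw [sin_neg] at hst
  have h' : -(a * sin t * cos φ) = b * sin φ * cos t := by
    field_simp at h; linarith
  have h1 := sin_sq_add_cos_sq t
  have h2 := sin_sq_add_cos_sq φ
  have hC : cos t * supportFn a b φ = a * cos φ := by
    refine (pow_left_inj₀ (by positivity) (by positivity) two_ne_zero).1 ?_
    rw [mul_pow, hsq]
    linear_combination (-(b * sin φ * cos t) + a * sin t * cos φ) * h' + a ^ 2 * cos φ ^ 2 * h1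
  have hS : sin t * supportFn a b φ = - (b * sin φ) := by
    have : a * cos φ * (sin t * supportFn a b φ + b * sin φ) = 0 := by
      linear_combination -supportFn a b φ * h' - b * sin φ * hC
    rcases mul_eq_zero.1 this with h | h
    · exact absurd h (by positivity)
    · linarith
  constructor
  · rw [contactX, eq_div_iff hh.ne']; linear_combination a * hC
  · rw [contactY, ← neg_div, eq_div_iff hh.ne']; linear_combination b * hS

end ContactPoints

section Region

variable {a b r u y : ℝ}

lemma circlePower_neg_iff (ha : 0 < a) (hb : 0 < b) (hy : 0 < y) {φ t : ℝ}
    (hφ : φ ∈ Ioo 0 (π / 2)) (ht : t ∈ Ioo (-(π / 2)) 0) (h : a * tan (-t) = b * tan φ) :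
    circlePower a b r u y t < 0 ↔ y < centerHeight a b r u φ := by
  obtain ⟨h1, h2⟩ := contact_eq_param ha hb hφ ht h
  have hY := contactY_pos ha hb hφ
  rw [circlePower, h1, h2, centerHeight, lt_sub_iff_add_lt, Real.lt_sqrt (by positivity)]
  constructor <;> intro h <;> linarith

lemma circlePower_pos_iff (ha : 0 < a) (hb : 0 < b) (hy : 0 < y) {φ t : ℝ}
    (hφ : φ ∈ Ioo 0 (π / 2)) (ht : t ∈ Ioo (-(π / 2)) 0) (h : a * tan (-t) = b * tan φ) :
    0 < circlePower a b r u y t ↔ centerHeight a b r u φ < y := by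
  obtain ⟨h1, h2⟩ := contact_eq_param ha hb hφ ht h
  have hY := contactY_pos ha hb hφ
  rw [circlePower, h1, h2, centerHeight, sub_lt_iff_lt_add, Real.sqrt_lt' (by positivity)]
  constructor <;> intro h <;> linarith

lemma arctan_mem {z : ℝ} (hz : 0 < z) : arctan z ∈ Ioo 0 (π / 2) :=
  ⟨Real.arctan_pos.2 hz, Real.arctan_lt_pi_div_two z⟩

lemma tan_pos_of_mem {φ : ℝ} (h : φ ∈ Ioo 0 (π / 2)) : 0 < tan φ :=
  Real.tan_pos_of_pos_of_lt_pi_div_two h.1 h.2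

lemma tan_lt_tan_of_mem {φ ψ : ℝ} (h : φ ∈ Ioo 0 (π / 2)) (h' : ψ ∈ Ioo 0 (π / 2))
    (hlt : φ < ψ) : tan φ < tan ψ :=
  Real.tan_lt_tan_of_nonneg_of_lt_pi_div_two h.1.le h'.2 hlt

lemma exists_neg_pos_iff_centerHeight (ha : 0 < a) (hb : 0 < b) (hy : 0 < y) :
    (∃ t₁ t₂, -(π / 2) < t₁ ∧ t₁ < t₂ ∧ t₂ < 0 ∧ circlePower a b r u y t₁ < 0 ∧
      0 < circlePower a b r u y t₂) ↔
    ∃ φ₂ φ₁, 0 < φ₂ ∧ φ₂ < φ₁ ∧ φ₁ < π / 2 ∧ centerHeight a b r u φ₂ < y ∧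
      y < centerHeight a b r u φ₁ := by
  constructor
  · rintro ⟨t₁, t₂, h1, h12, h2, hn, hp⟩
    have m1 : t₁ ∈ Ioo (-(π / 2)) 0 := ⟨h1, h12.trans h2⟩
    have m2 : t₂ ∈ Ioo (-(π / 2)) 0 := ⟨h1.trans h12, h2⟩
    have m1' : -t₁ ∈ Ioo 0 (π / 2) := ⟨by linarith, by linarith⟩
    have m2' : -t₂ ∈ Ioo 0 (π / 2) := ⟨by linarith, by linarith⟩
    have hlt := tan_lt_tan_of_mem m2' m1' (by linarith)
    have k1 := arctan_mem (mul_pos (div_pos ha hb) (tan_pos_of_mem m1'))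
    have k2 := arctan_mem (mul_pos (div_pos ha hb) (tan_pos_of_mem m2'))
    refine ⟨_, _, k2.1, Real.arctan_strictMono (by gcongr), k1.2,
      (circlePower_pos_iff ha hb hy k2 m2 ?_).1 hp, (circlePower_neg_iff ha hb hy k1 m1 ?_).1 hn⟩
    · rw [Real.tan_arctan]; field_simp
    · rw [Real.tan_arctan]; field_simp
  · rintro ⟨φ₂, φ₁, h1, h12, h2, hn, hp⟩
    have m2 : φ₂ ∈ Ioo 0 (π / 2) := ⟨h1, h12.trans h2⟩
    have m1 : φ₁ ∈ Ioo 0 (π / 2) := ⟨h1.trans h12, h2⟩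
    have hlt := tan_lt_tan_of_mem m2 m1 h12
    have k1 := arctan_mem (mul_pos (div_pos hb ha) (tan_pos_of_mem m1))
    have k2 := arctan_mem (mul_pos (div_pos hb ha) (tan_pos_of_mem m2))
    have n1 : -arctan (b / a * tan φ₁) ∈ Ioo (-(π / 2)) 0 := ⟨by linarith [k1.2], by linarith [k1.1]⟩
    have n2 : -arctan (b / a * tan φ₂) ∈ Ioo (-(π / 2)) 0 := ⟨by linarith [k2.2], by linarith [k2.1]⟩
    refine ⟨_, _, n1.1, neg_lt_neg (Real.arctan_strictMono (by gcongr)), n2.2,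
      (circlePower_neg_iff ha hb hy m1 n1 ?_).2 hp, (circlePower_pos_iff ha hb hy m2 n2 ?_).2 hn⟩
    · rw [neg_neg, Real.tan_arctan]; field_simp
    · rw [neg_neg, Real.tan_arctan]; field_simp

lemma sq_contactX_sub_lt (ha : 0 < a) (hb : 0 < b) (har : a < r) (hu : 0 < u) (hua : u < a) {φ : ℝ}
    (hφ : φ ∈ Ioo 0 (π / 2)) : (contactX a b φ - u) ^ 2 < r ^ 2 := by
  have := contactX_pos ha hb hφ
  have := contactX_lt ha hb hφ
  exact sq_lt_sq' (by linarith) (by linarith)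

lemma hasDerivAt_centerHeight (ha : 0 < a) (hb : 0 < b) (har : a < r) (hu : 0 < u) (hua : u < a)
    {φ : ℝ} (hφ : φ ∈ Ioo 0 (π / 2)) :
    HasDerivAt (centerHeight a b r u) (curvatureRadius a b φ / √(r ^ 2 - (contactX a b φ - u) ^ 2) *
      ((contactX a b φ - u) * sin φ - √(r ^ 2 - (contactX a b φ - u) ^ 2) * cos φ)) φ := by
  have hlt := sub_pos.2 (sq_contactX_sub_lt ha hb har hu hua hφ)
  have hs := (Real.sqrt_pos.2 hlt).ne'
  refine ((((((hasDerivAt_contactX ha hb φ).sub_const u).pow 2).const_sub (r ^ 2)).sqrt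
    hlt.ne').sub (hasDerivAt_contactY ha hb φ)).congr_deriv ?_
  simp only [Pi.pow_apply]
  field_simp
  simp
  ring

lemma strictAntiOn_centerHeight (ha : 0 < a) (hb : 0 < b) (har : a < r) (hu : 0 < u) (hua : u < a)
    {l m : ℝ} (hl : 0 ≤ l) (hm : m ≤ π / 2) (h : ∀ φ ∈ Ioo l m, parallelX a b r φ < u) :
    StrictAntiOn (centerHeight a b r u) (Icc l m) := by
  refine strictAntiOn_of_deriv_neg (convex_Icc _ _) (continuous_centerHeight ha hb r u).continuousOn
    fun φ hφ => ?_
  rw [interior_Icc] at hφ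
  have hφ' : φ ∈ Ioo 0 (π / 2) := ⟨hl.trans_lt hφ.1, hφ.2.trans_le hm⟩
  rw [(hasDerivAt_centerHeight ha hb har hu hua hφ').deriv]
  have hlt := sub_pos.2 (sq_contactX_sub_lt ha hb har hu hua hφ')
  have hs := Real.sqrt_pos.2 hlt
  refine mul_neg_of_pos_of_neg (div_pos (curvatureRadius_pos ha hb φ) hs) (sub_neg.2 ?_)
  have hU := h φ hφ
  rw [parallelX] at hU
  have hsq := Real.sq_sqrt hlt.le
  set w := contactX a b φ - u
  have hw : w < r * cos φ := by simp only [w]; linarith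
  have hsn := sin_pos_of_mem hφ'
  have hcs := cos_pos_of_mem hφ'
  rcases le_or_gt w 0 with h0 | h0
  · have := mul_pos hs hcs
    have := mul_nonneg (neg_nonneg.2 h0) hsn.le
    linarith
  · refine lt_of_pow_lt_pow_left₀ 2 (by positivity) ?_
    rw [mul_pow, mul_pow, hsq, sin_sq]
    nlinarith [pow_lt_pow_left₀ hw h0.le two_ne_zero]

lemma strictMonoOn_centerHeight (ha : 0 < a) (hb : 0 < b) (har : a < r) (hu : 0 < u) (hua : u < a)
    {l m : ℝ} (hl : 0 ≤ l) (hm : m ≤ π / 2) (h : ∀ φ ∈ Ioo l m, u < parallelX a b r φ) :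
    StrictMonoOn (centerHeight a b r u) (Icc l m) := by
  refine strictMonoOn_of_deriv_pos (convex_Icc _ _) (continuous_centerHeight ha hb r u).continuousOn
    fun φ hφ => ?_
  rw [interior_Icc] at hφ
  have hφ' : φ ∈ Ioo 0 (π / 2) := ⟨hl.trans_lt hφ.1, hφ.2.trans_le hm⟩
  rw [(hasDerivAt_centerHeight ha hb har hu hua hφ').deriv]
  have hlt := sub_pos.2 (sq_contactX_sub_lt ha hb har hu hua hφ')
  have hs := Real.sqrt_pos.2 hlt
  refine mul_pos (div_pos (curvatureRadius_pos ha hb φ) hs) (sub_pos.2 ?_)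
  have hU := h φ hφ
  rw [parallelX] at hU
  have hsq := Real.sq_sqrt hlt.le
  set w := contactX a b φ - u
  have hw : r * cos φ < w := by simp only [w]; linarith
  have hsn := sin_pos_of_mem hφ'
  have hcs := cos_pos_of_mem hφ'
  have hrc : 0 < r * cos φ := mul_pos (ha.trans har) hcs
  refine lt_of_pow_lt_pow_left₀ 2 (mul_pos (hrc.trans hw) hsn).le ?_
  rw [mul_pow, mul_pow, hsq, sin_sq]
  nlinarith [pow_lt_pow_left₀ hw hrc.le two_ne_zero]

lemma centerHeight_eq_parallelY (hr : 0 < r) {φ : ℝ} (hφ : φ ∈ Ioo 0 (π / 2))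
    (h : parallelX a b r φ = u) : centerHeight a b r u φ = parallelY a b r φ := by
  have e : contactX a b φ - u = r * cos φ := by rw [← h, parallelX]; ring
  have hs := sin_pos_of_mem hφ
  rw [centerHeight, parallelY, e, show r ^ 2 - (r * cos φ) ^ 2 = (r * sin φ) ^ 2 by
    rw [mul_pow, mul_pow, sin_sq]; ring, Real.sqrt_sq (by positivity)]

lemma antitone_contactX (ha : 0 < a) (hb : 0 < b) : AntitoneOn (contactX a b) (Icc 0 (π / 2)) := by
  refine antitoneOn_of_deriv_nonpos (convex_Icc _ _) (continuous_contactX ha hb).continuousOn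
    (fun φ _ => (hasDerivAt_contactX ha hb φ).differentiableAt.differentiableWithinAt) fun φ hφ => ?_
  rw [interior_Icc] at hφ
  rw [(hasDerivAt_contactX ha hb φ).deriv]
  have := mul_pos (curvatureRadius_pos ha hb φ) (sin_pos_of_mem hφ)
  linarith

lemma monotone_contactY (ha : 0 < a) (hb : 0 < b) : MonotoneOn (contactY a b) (Icc 0 (π / 2)) := by
  refine monotoneOn_of_deriv_nonneg (convex_Icc _ _) (continuous_contactY ha hb).continuousOn
    (fun φ _ => (hasDerivAt_contactY ha hb φ).differentiableAt.differentiableWithinAt) fun φ hφ => ?_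
  rw [interior_Icc] at hφ
  rw [(hasDerivAt_contactY ha hb φ).deriv]
  exact (mul_pos (curvatureRadius_pos ha hb φ) (cos_pos_of_mem hφ)).le

lemma lt_of_exists_centerHeight (ha : 0 < a) (hb : 0 < b)
    (h : ∃ φ₂ φ₁, 0 < φ₂ ∧ φ₂ < φ₁ ∧ φ₁ < π / 2 ∧ centerHeight a b r u φ₂ < y ∧
      y < centerHeight a b r u φ₁) : u < a := by
  obtain ⟨φ₂, φ₁, h1, h12, h2, hn, hp⟩ := h
  by_contra! hu
  have hX := antitone_contactX ha hb ⟨h1.le, (h12.trans h2).le⟩ ⟨(h1.trans h12).le, h2.le⟩ h12.le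
  have hY := monotone_contactY ha hb ⟨h1.le, (h12.trans h2).le⟩ ⟨(h1.trans h12).le, h2.le⟩ h12.le
  have := contactX_lt ha hb ⟨h1, h12.trans h2⟩
  have : √(r ^ 2 - (contactX a b φ₁ - u) ^ 2) ≤ √(r ^ 2 - (contactX a b φ₂ - u) ^ 2) :=
    Real.sqrt_le_sqrt (by nlinarith)
  have := hn.trans hp
  simp only [centerHeight] at this
  linarith

end Region

section Cusp

variable {a b r : ℝ}

lemma betaAng_mem (hb : 0 < b) (hba : b < a) (har : a < r) (hrb : r * b < a ^ 2) :
    betaAng a b r ∈ Ioo 0 (π / 2) := by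
  have ha := hb.trans hba
  have h1 : 0 < r ^ 2 - a ^ 2 := by nlinarith
  have h2 : 0 < a ^ 4 - r ^ 2 * b ^ 2 := by
    have := pow_lt_pow_left₀ hrb (by nlinarith) two_ne_zero
    nlinarith
  exact arctan_mem (by positivity)

lemma supportFn_betaAng (hb : 0 < b) (hba : b < a) (har : a < r) (hrb : r * b < a ^ 2) :
    supportFn a b (betaAng a b r) = a ^ 2 / r := by
  have ha := hb.trans hba
  have hr := ha.trans har
  have h1 : 0 < r ^ 2 - a ^ 2 := by nlinarith
  have h2 : 0 < a ^ 4 - r ^ 2 * b ^ 2 := by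
    have := pow_lt_pow_left₀ hrb (by nlinarith) two_ne_zero
    nlinarith
  have h3 : 0 < a ^ 2 - b ^ 2 := by nlinarith
  refine (pow_left_inj₀ (supportFn_pos ha hb _).le (by positivity) two_ne_zero).1 ?_
  rw [supportFn_sq ha hb, sin_sq, betaAng, Real.cos_sq_arctan, div_pow, mul_pow, Real.sq_sqrt h1.le,
    Real.sq_sqrt h2.le]
  have h4 : 1 + a ^ 2 * (r ^ 2 - a ^ 2) / (a ^ 4 - r ^ 2 * b ^ 2) =
      r ^ 2 * (a ^ 2 - b ^ 2) / (a ^ 4 - r ^ 2 * b ^ 2) := by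
    field_simp; ring
  rw [h4]
  field_simp
  ring

lemma parallelX_betaAng (hb : 0 < b) (hba : b < a) (har : a < r) (hrb : r * b < a ^ 2) :
    parallelX a b r (betaAng a b r) = 0 := by
  have ha := hb.trans hba
  have hr := ha.trans har
  rw [parallelX, contactX, supportFn_betaAng hb hba har hrb]
  field_simp
  ring

lemma parallelX_pi_div_two : parallelX a b r (π / 2) = 0 := by
  simp [parallelX, contactX]

lemma le_supportFn (hb : 0 < b) (hba : b < a) (φ : ℝ) : b ≤ supportFn a b φ := by
  refine le_of_sq_le_sq ?_ (supportFn_pos (hb.trans hba) hb φ).le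
  rw [supportFn_sq (hb.trans hba) hb, sin_sq]
  nlinarith [mul_nonneg (by nlinarith : 0 ≤ a ^ 2 - b ^ 2) (sq_nonneg (cos φ))]

lemma strictMonoOn_curvatureRadius (hb : 0 < b) (hba : b < a) :
    StrictMonoOn (curvatureRadius a b) (Icc 0 (π / 2)) := by
  have ha := hb.trans hba
  intro φ hφ ψ hψ hlt
  have hc := cos_lt_cos_of_nonneg_of_le_pi_div_two hφ.1 hψ.2 hlt
  have hc0 := cos_nonneg_of_mem_Icc ⟨by linarith [hψ.1, Real.pi_pos], hψ.2⟩
  have h : supportFn a b ψ < supportFn a b φ := by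
    refine lt_of_pow_lt_pow_left₀ 2 (supportFn_pos ha hb φ).le ?_
    rw [supportFn_sq ha hb, supportFn_sq ha hb, sin_sq, sin_sq]
    nlinarith [mul_pos (by nlinarith : 0 < a ^ 2 - b ^ 2)
      (sub_pos.2 (pow_lt_pow_left₀ hc hc0 two_ne_zero))]
  exact div_lt_div_of_pos_left (by positivity) (pow_pos (supportFn_pos ha hb ψ) 3)
    (pow_lt_pow_left₀ h (supportFn_pos ha hb ψ).le three_ne_zero)

lemma exists_cusp (hb : 0 < b) (hba : b < a) (har : a < r) (hrb : r * b < a ^ 2) :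
    ∃ κ ∈ Ioo (betaAng a b r) (π / 2), curvatureRadius a b κ = r := by
  have ha := hb.trans hba
  have hr := ha.trans har
  refine intermediate_value_Ioo (betaAng_mem hb hba har hrb).2.le
    (continuous_curvatureRadius ha hb).continuousOn ⟨?_, ?_⟩
  · rw [curvatureRadius, supportFn_betaAng hb hba har hrb, div_lt_iff₀ (by positivity)]
    have h := pow_lt_pow_left₀ hrb (by positivity) two_ne_zero
    rw [div_pow, ← mul_div_assoc, lt_div_iff₀ (by positivity)]
    have := mul_pos (mul_pos (pow_pos ha 2) hr) (sub_pos.2 h)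
    nlinarith
  · have : supportFn a b (π / 2) = b := by simp [supportFn, Real.sqrt_sq hb.le]
    rw [curvatureRadius, this, lt_div_iff₀ (by positivity)]
    nlinarith [mul_pos (pow_pos hb 2) (sub_pos.2 hrb)]

lemma parallelY_pos (hb : 0 < b) (hba : b < a) (har : a < r) {φ : ℝ} (hφ : φ ∈ Ioo 0 (π / 2)) :
    0 < parallelY a b r φ := by
  have ha := hb.trans hba
  have hh := supportFn_pos ha hb φ
  rw [parallelY, contactY, sub_pos, div_lt_iff₀ hh]
  have := le_supportFn hb hba φ
  have h2 : b ^ 2 < r * supportFn a b φ := by nlinarith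
  nlinarith [mul_pos (sin_pos_of_mem hφ) (sub_pos.2 h2)]

variable {κ : ℝ}

lemma strictMonoOn_parallelX (hb : 0 < b) (hba : b < a) (hκ : κ ∈ Ioo 0 (π / 2))
    (hκr : curvatureRadius a b κ = r) : StrictMonoOn (parallelX a b r) (Icc 0 κ) := by
  have ha := hb.trans hba
  refine strictMonoOn_of_deriv_pos (convex_Icc _ _) (continuous_parallelX ha hb r).continuousOn
    fun φ hφ => ?_
  rw [interior_Icc] at hφ
  rw [(hasDerivAt_parallelX ha hb r φ).deriv]
  have hφ' : φ ∈ Ioo 0 (π / 2) := ⟨hφ.1, hφ.2.trans hκ.2⟩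
  have := strictMonoOn_curvatureRadius hb hba (Ioo_subset_Icc_self hφ') (Ioo_subset_Icc_self hκ) hφ.2
  exact mul_pos (by linarith) (sin_pos_of_mem hφ')

lemma strictAntiOn_parallelX (hb : 0 < b) (hba : b < a) (hκ : κ ∈ Ioo 0 (π / 2))
    (hκr : curvatureRadius a b κ = r) : StrictAntiOn (parallelX a b r) (Icc κ (π / 2)) := by
  have ha := hb.trans hba
  refine strictAntiOn_of_deriv_neg (convex_Icc _ _) (continuous_parallelX ha hb r).continuousOn
    fun φ hφ => ?_
  rw [interior_Icc] at hφ
  rw [(hasDerivAt_parallelX ha hb r φ).deriv]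
  have hφ' : φ ∈ Ioo 0 (π / 2) := ⟨hκ.1.trans hφ.1, hφ.2⟩
  have := strictMonoOn_curvatureRadius hb hba (Ioo_subset_Icc_self hκ) (Ioo_subset_Icc_self hφ') hφ.1
  exact mul_neg_of_neg_of_pos (by linarith) (sin_pos_of_mem hφ')

lemma image_parallelX_left (hb : 0 < b) (hba : b < a) (har : a < r) (hrb : r * b < a ^ 2)
    (hκ : κ ∈ Ioo (betaAng a b r) (π / 2)) (hκr : curvatureRadius a b κ = r) :
    parallelX a b r '' Ioo (betaAng a b r) κ = Ioo 0 (parallelX a b r κ) := by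
  have hβ := betaAng_mem hb hba har hrb
  have hm := strictMonoOn_parallelX hb hba ⟨hβ.1.trans hκ.1, hκ.2⟩ hκr
  apply Subset.antisymm
  · rintro _ ⟨φ, hφ, rfl⟩
    rw [← parallelX_betaAng hb hba har hrb]
    have hφ' : φ ∈ Icc 0 κ := ⟨(hβ.1.trans hφ.1).le, hφ.2.le⟩
    exact ⟨hm ⟨hβ.1.le, hκ.1.le⟩ hφ' hφ.1, hm hφ' (right_mem_Icc.2 (hβ.1.trans hκ.1).le) hφ.2⟩
  · have := intermediate_value_Ioo hκ.1.le
      (continuous_parallelX (hb.trans hba) hb r).continuousOn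
    rwa [parallelX_betaAng hb hba har hrb] at this

lemma image_parallelX_right (hb : 0 < b) (hba : b < a)
    (hκ : κ ∈ Ioo 0 (π / 2)) (hκr : curvatureRadius a b κ = r) :
    parallelX a b r '' Ioo κ (π / 2) = Ioo 0 (parallelX a b r κ) := by
  have hm := strictAntiOn_parallelX hb hba hκ hκr
  apply Subset.antisymm
  · rintro _ ⟨φ, hφ, rfl⟩
    rw [← parallelX_pi_div_two (a := a) (b := b) (r := r)]
    have hφ' := Ioo_subset_Icc_self hφ
    exact ⟨hm hφ' (right_mem_Icc.2 hκ.2.le) hφ.2, hm (left_mem_Icc.2 hκ.2.le) hφ' hφ.1⟩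
  · have := intermediate_value_Ioo' hκ.2.le
      (continuous_parallelX (hb.trans hba) hb r).continuousOn
    rwa [parallelX_pi_div_two] at this

lemma strictMonoOn_centerHeight_between (hb : 0 < b) (hba : b < a) (har : a < r)
    (hrb : r * b < a ^ 2) (hκ : κ ∈ Ioo (betaAng a b r) (π / 2)) (hκr : curvatureRadius a b κ = r)
    {u ψ₁ ψ₂ : ℝ} (hu : 0 < u) (hψ₂ : ψ₂ ∈ Ioo (betaAng a b r) κ) (hψ₁ : ψ₁ ∈ Ioo κ (π / 2))
    (e₂ : parallelX a b r ψ₂ = u) (e₁ : parallelX a b r ψ₁ = u) :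
    StrictMonoOn (centerHeight a b r u) (Icc ψ₂ ψ₁) := by
  have ha := hb.trans hba
  have hβ := betaAng_mem hb hba har hrb
  have hκ' : κ ∈ Ioo 0 (π / 2) := ⟨hβ.1.trans hκ.1, hκ.2⟩
  have hmono := strictMonoOn_parallelX hb hba hκ' hκr
  have hanti := strictAntiOn_parallelX hb hba hκ' hκr
  have m₂ : ψ₂ ∈ Ioo 0 (π / 2) := ⟨hβ.1.trans hψ₂.1, hψ₂.2.trans hκ.2⟩
  have m₁ : ψ₁ ∈ Ioo 0 (π / 2) := ⟨hκ'.1.trans hψ₁.1, hψ₁.2⟩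
  have hua : u < a := by
    have h1 := contactX_lt ha hb m₂
    have h2 := mul_pos (ha.trans har) (cos_pos_of_mem m₂)
    rw [parallelX] at e₂
    linarith
  refine strictMonoOn_centerHeight ha hb har hu hua m₂.1.le m₁.2.le fun φ hφ => ?_
  rcases le_or_gt φ κ with h | h
  · rw [← e₂]
    exact hmono ⟨m₂.1.le, hψ₂.2.le⟩ ⟨(m₂.1.trans hφ.1).le, h⟩ hφ.1
  · rw [← e₁]
    exact hanti ⟨h.le, (hφ.2.trans m₁.2).le⟩ ⟨hψ₁.1.le, m₁.2.le⟩ hφ.2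

lemma parallelY_lt_parallelY (hb : 0 < b) (hba : b < a) (har : a < r)
    (hrb : r * b < a ^ 2) (hκ : κ ∈ Ioo (betaAng a b r) (π / 2)) (hκr : curvatureRadius a b κ = r)
    {u ψ₁ ψ₂ : ℝ} (hu : 0 < u) (hψ₂ : ψ₂ ∈ Ioo (betaAng a b r) κ) (hψ₁ : ψ₁ ∈ Ioo κ (π / 2))
    (e₂ : parallelX a b r ψ₂ = u) (e₁ : parallelX a b r ψ₁ = u) :
    parallelY a b r ψ₂ < parallelY a b r ψ₁ := by
  have hr := (hb.trans hba).trans har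
  have hβ := betaAng_mem hb hba har hrb
  have m₂ : ψ₂ ∈ Ioo 0 (π / 2) := ⟨hβ.1.trans hψ₂.1, hψ₂.2.trans hκ.2⟩
  have m₁ : ψ₁ ∈ Ioo 0 (π / 2) := ⟨(hβ.1.trans hκ.1).trans hψ₁.1, hψ₁.2⟩
  have h21 : ψ₂ < ψ₁ := hψ₂.2.trans hψ₁.1
  rw [← centerHeight_eq_parallelY hr m₂ e₂, ← centerHeight_eq_parallelY hr m₁ e₁]
  exact strictMonoOn_centerHeight_between hb hba har hrb hκ hκr hu hψ₂ hψ₁ e₂ e₁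
    (left_mem_Icc.2 h21.le) (right_mem_Icc.2 h21.le) h21

lemma exists_centerHeight_iff (hb : 0 < b) (hba : b < a) (har : a < r) (hrb : r * b < a ^ 2)
    (hκ : κ ∈ Ioo (betaAng a b r) (π / 2)) (hκr : curvatureRadius a b κ = r)
    {u y : ℝ} (hu : 0 < u) :
    (∃ φ₂ φ₁, 0 < φ₂ ∧ φ₂ < φ₁ ∧ φ₁ < π / 2 ∧ centerHeight a b r u φ₂ < y ∧
      y < centerHeight a b r u φ₁) ↔
    ∃ ψ₂ ∈ Ioo (betaAng a b r) κ, ∃ ψ₁ ∈ Ioo κ (π / 2), parallelX a b r ψ₂ = u ∧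
      parallelX a b r ψ₁ = u ∧ parallelY a b r ψ₂ < y ∧ y < parallelY a b r ψ₁ := by
  have ha := hb.trans hba
  have hr := ha.trans har
  have hβ := betaAng_mem hb hba har hrb
  have hκ' : κ ∈ Ioo 0 (π / 2) := ⟨hβ.1.trans hκ.1, hκ.2⟩
  have hmono := strictMonoOn_parallelX hb hba hκ' hκr
  have hanti := strictAntiOn_parallelX hb hba hκ' hκr
  constructor
  · intro h
    have hua := lt_of_exists_centerHeight ha hb h
    obtain ⟨φ₂, φ₁, h1, h12, h2, hn, hp⟩ := h
    have huκ : u < parallelX a b r κ := by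
      by_contra! hle
      have hl := strictAntiOn_centerHeight ha hb har hu hua le_rfl hκ.2.le fun φ hφ =>
        (hmono (Ioo_subset_Icc_self hφ) (right_mem_Icc.2 hκ'.1.le) hφ.2).trans_le hle
      have hr := strictAntiOn_centerHeight ha hb har hu hua hκ'.1.le le_rfl fun φ hφ =>
        (hanti (left_mem_Icc.2 hκ'.2.le) (Ioo_subset_Icc_self hφ) hφ.1).trans_le hle
      have := hl.union hr (isGreatest_Icc hκ'.1.le) (isLeast_Icc hκ'.2.le)
      rw [Icc_union_Icc_eq_Icc hκ'.1.le hκ'.2.le] at this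
      have := this ⟨h1.le, (h12.trans h2).le⟩ ⟨(h1.trans h12).le, h2.le⟩ h12
      linarith
    obtain ⟨ψ₂, hψ₂, e₂⟩ : u ∈ parallelX a b r '' Ioo (betaAng a b r) κ := by
      rw [image_parallelX_left hb hba har hrb hκ hκr]; exact ⟨hu, huκ⟩
    obtain ⟨ψ₁, hψ₁, e₁⟩ : u ∈ parallelX a b r '' Ioo κ (π / 2) := by
      rw [image_parallelX_right hb hba hκ' hκr]; exact ⟨hu, huκ⟩
    have m₂ : ψ₂ ∈ Ioo 0 (π / 2) := ⟨hβ.1.trans hψ₂.1, hψ₂.2.trans hκ.2⟩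
    have m₁ : ψ₁ ∈ Ioo 0 (π / 2) := ⟨hκ'.1.trans hψ₁.1, hψ₁.2⟩
    have hS₁ : StrictAntiOn (centerHeight a b r u) (Icc 0 ψ₂) :=
      strictAntiOn_centerHeight ha hb har hu hua le_rfl m₂.2.le fun φ hφ => by
        rw [← e₂]
        exact hmono ⟨hφ.1.le, (hφ.2.trans hψ₂.2).le⟩ ⟨m₂.1.le, hψ₂.2.le⟩ hφ.2
    have hS₂ := strictMonoOn_centerHeight_between hb hba har hrb hκ hκr hu hψ₂ hψ₁ e₂ e₁
    have hS₃ : StrictAntiOn (centerHeight a b r u) (Icc ψ₁ (π / 2)) :=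
      strictAntiOn_centerHeight ha hb har hu hua m₁.1.le le_rfl fun φ hφ => by
        rw [← e₁]
        exact hanti ⟨hψ₁.1.le, m₁.2.le⟩ ⟨(hψ₁.1.trans hφ.1).le, hφ.2.le⟩ hφ.1
    have h21 : ψ₂ < ψ₁ := hψ₂.2.trans hψ₁.1
    have hlt := hn.trans hp
    have a₁ : φ₂ < ψ₁ := by
      by_contra! h
      have := hS₃ ⟨h, (h12.trans h2).le⟩ ⟨h.trans h12.le, h2.le⟩ h12
      linarith
    have a₂ : ψ₂ < φ₁ := by
      by_contra! h
      have := hS₁ ⟨h1.le, h12.le.trans h⟩ ⟨(h1.trans h12).le, h⟩ h12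
      linarith
    refine ⟨ψ₂, hψ₂, ψ₁, hψ₁, e₂, e₁, ?_, ?_⟩
    · rw [← centerHeight_eq_parallelY hr m₂ e₂]
      refine lt_of_le_of_lt ?_ hn
      rcases le_total φ₂ ψ₂ with h | h
      · exact hS₁.antitoneOn ⟨h1.le, h⟩ (right_mem_Icc.2 m₂.1.le) h
      · exact hS₂.monotoneOn (left_mem_Icc.2 h21.le) ⟨h, a₁.le⟩ h
    · rw [← centerHeight_eq_parallelY hr m₁ e₁]
      refine lt_of_lt_of_le hp ?_
      rcases le_total φ₁ ψ₁ with h | h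
      · exact hS₂.monotoneOn ⟨a₂.le, h⟩ (right_mem_Icc.2 h21.le) h
      · exact hS₃.antitoneOn (left_mem_Icc.2 m₁.2.le) ⟨h, h2.le⟩ h
  · rintro ⟨ψ₂, hψ₂, ψ₁, hψ₁, e₂, e₁, hn, hp⟩
    have m₂ : ψ₂ ∈ Ioo 0 (π / 2) := ⟨hβ.1.trans hψ₂.1, hψ₂.2.trans hκ.2⟩
    have m₁ : ψ₁ ∈ Ioo 0 (π / 2) := ⟨hκ'.1.trans hψ₁.1, hψ₁.2⟩
    refine ⟨ψ₂, ψ₁, m₂.1, hψ₂.2.trans hψ₁.1, m₁.2, ?_, ?_⟩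
    · rwa [centerHeight_eq_parallelY hr m₂ e₂]
    · rwa [centerHeight_eq_parallelY hr m₁ e₁]

end Cusp

section Primitive

variable {a b : ℝ}

lemma ecc_sq (hb : 0 < b) (hba : b < a) : ecc a b ^ 2 = (a ^ 2 - b ^ 2) / a ^ 2 := by
  rw [ecc, div_pow, Real.sq_sqrt (by nlinarith)]

lemma mul_sqrt_one_sub_ecc_sq (hb : 0 < b) (hba : b < a) (φ : ℝ) :
    a * √(1 - ecc a b ^ 2 * sin φ ^ 2) = supportFn a b φ := by
  have ha := hb.trans hba
  rw [ecc_sq hb hba, supportFn, ← Real.sqrt_sq ha.le, ← Real.sqrt_mul (sq_nonneg a),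
    Real.sqrt_sq ha.le, cos_sq']
  congr 1
  field_simp
  ring

lemma hasDerivAt_Einc (ε φ : ℝ) : HasDerivAt (Einc ε) (√(1 - ε ^ 2 * sin φ ^ 2)) φ := by
  have hc : Continuous fun θ : ℝ => √(1 - ε ^ 2 * sin θ ^ 2) := by fun_prop
  exact intervalIntegral.integral_hasDerivAt_right (hc.intervalIntegrable _ _)
    (hc.stronglyMeasurableAtFilter _ _) hc.continuousAt

/-- A primitive of `4 * parallelX' * parallelY` on `(0, π)`. -/
def areaPrimitive (a b r φ : ℝ) : ℝ :=
  2 * r ^ 2 * φ + 2 * a * b * (π / 2 - arctan (a * cos φ / (b * sin φ)))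
    - 4 * r * a * Einc (ecc a b) φ
    + 2 * r * (a ^ 2 - b ^ 2) * (sin φ * cos φ / supportFn a b φ)
    + 2 * (parallelX a b r φ * parallelY a b r φ)

lemma hasDerivAt_areaPrimitive (hb : 0 < b) (hba : b < a) (r : ℝ) {φ : ℝ} (hs : sin φ ≠ 0) :
    HasDerivAt (areaPrimitive a b r)
      (4 * ((r - curvatureRadius a b φ) * sin φ * parallelY a b r φ)) φ := by
  have ha := hb.trans hba
  have hh := (supportFn_pos ha hb φ).ne'
  have hsq := supportFn_sq ha hb φ
  have d1 : HasDerivAt (fun t : ℝ => 2 * r ^ 2 * t) (2 * r ^ 2) φ := by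
    simpa using (hasDerivAt_id φ).const_mul (2 * r ^ 2)
  have d2 := ((((hasDerivAt_cos φ).const_mul a).div ((hasDerivAt_sin φ).const_mul b)
    (mul_ne_zero hb.ne' hs)).arctan.const_sub (π / 2)).const_mul (2 * a * b)
  have d3 := (hasDerivAt_Einc (ecc a b) φ).const_mul (4 * r * a)
  have d4 := (((hasDerivAt_sin φ).mul (hasDerivAt_cos φ)).div (hasDerivAt_supportFn ha hb φ)
    hh).const_mul (2 * r * (a ^ 2 - b ^ 2))
  have d5 := ((hasDerivAt_parallelX ha hb r φ).mul (hasDerivAt_parallelY ha hb r φ)).const_mul 2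
  refine ((((d1.add d2).sub d3).add d4).add d5).congr_deriv ?_
  have e2 : 2 * a * b * -(1 / (1 + (a * cos φ / (b * sin φ)) ^ 2) *
      ((a * -sin φ * (b * sin φ) - a * cos φ * (b * cos φ)) / (b * sin φ) ^ 2)) =
      2 * a ^ 2 * b ^ 2 / supportFn a b φ ^ 2 := by
    have : 0 < a ^ 2 * cos φ ^ 2 + b ^ 2 * sin φ ^ 2 := hsq ▸ by positivity
    have h1 : 1 + (a * cos φ / (b * sin φ)) ^ 2 =
        (a ^ 2 * cos φ ^ 2 + b ^ 2 * sin φ ^ 2) / (b * sin φ) ^ 2 := by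
      field_simp; ring
    have h2 : a * -sin φ * (b * sin φ) - a * cos φ * (b * cos φ) = -(a * b) := by
      linear_combination -(a * b) * sin_sq_add_cos_sq φ
    rw [h1, h2, hsq]
    field_simp
  have e3 : 4 * r * a * √(1 - ecc a b ^ 2 * sin φ ^ 2) = 4 * r * supportFn a b φ := by
    rw [← mul_sqrt_one_sub_ecc_sq hb hba]; ring
  have e4 : 2 * r * (a ^ 2 - b ^ 2) *
      (((cos φ * cos φ + sin φ * -sin φ) * supportFn a b φ -
        sin φ * cos φ * (-(a ^ 2 - b ^ 2) * sin φ * cos φ / supportFn a b φ)) /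
          supportFn a b φ ^ 2) = 2 * r * (supportFn a b φ - curvatureRadius a b φ) := by
    have hc : cos φ ^ 2 = 1 - sin φ ^ 2 := cos_sq' φ
    rw [hc] at hsq
    have h4 : supportFn a b φ ^ 4 = (a ^ 2 * (1 - sin φ ^ 2) + b ^ 2 * sin φ ^ 2) ^ 2 := by
      rw [← hsq]; ring
    rw [curvatureRadius]
    field_simp
    rw [h4, hsq, hc]
    ring
  have e5 : sin φ * parallelY a b r φ - cos φ * parallelX a b r φ = r - supportFn a b φ := by
    rw [parallelX, parallelY, contactX, contactY]
    field_simp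
    linear_combination r * supportFn a b φ * sin_sq_add_cos_sq φ + hsq
  have e6 : curvatureRadius a b φ * supportFn a b φ = a ^ 2 * b ^ 2 / supportFn a b φ ^ 2 := by
    rw [curvatureRadius]; field_simp
  simp only [Pi.mul_apply, Pi.div_apply]
  rw [e2, e3, e4]
  linear_combination -2 * (r - curvatureRadius a b φ) * e5 - 2 * e6

variable {r : ℝ}

lemma areaPrimitive_betaAng (hb : 0 < b) (hba : b < a) (har : a < r) (hrb : r * b < a ^ 2) :
    areaPrimitive a b r (betaAng a b r) = Ffun a b r (betaAng a b r) := by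
  have ha := hb.trans hba
  have hβ := betaAng_mem hb hba har hrb
  have hs := sin_pos_of_mem hβ
  have hc := cos_pos_of_mem hβ
  have hh := supportFn_pos ha hb (betaAng a b r)
  have harc : arctan (a * cos (betaAng a b r) / (b * sin (betaAng a b r))) =
      π / 2 - arctan (b / a * tan (betaAng a b r)) := by
    rw [tan_eq_sin_div_cos, ← arctan_inv_of_pos (by positivity)]
    congr 1
    field_simp
  have hq : √(1 - ecc a b ^ 2 * sin (betaAng a b r) ^ 2) =
      supportFn a b (betaAng a b r) / a := by
    rw [← mul_sqrt_one_sub_ecc_sq hb hba]; field_simp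
  rw [areaPrimitive, Ffun, harc, parallelX_betaAng hb hba har hrb, hq, ecc_sq hb hba, sin_two_mul]
  field_simp
  ring

lemma areaPrimitive_pi_div_two (a b r : ℝ) :
    areaPrimitive a b r (π / 2) = Astar a b r := by
  simp [areaPrimitive, Astar, Ecomp, parallelX, contactX]
  ring

lemma integral_parallelX_deriv_mul_parallelY (hb : 0 < b) (hba : b < a) (har : a < r)
    (hrb : r * b < a ^ 2) :
    ∫ φ in betaAng a b r..π / 2, (r - curvatureRadius a b φ) * sin φ * parallelY a b r φ =
      (Astar a b r - Ffun a b r (betaAng a b r)) / 4 := by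
  have ha := hb.trans hba
  have hβ := betaAng_mem hb hba har hrb
  have hcont : Continuous fun φ =>
      4 * ((r - curvatureRadius a b φ) * sin φ * parallelY a b r φ) := by
    have := continuous_curvatureRadius ha hb
    have := continuous_parallelY ha hb r
    fun_prop
  have := intervalIntegral.integral_eq_sub_of_hasDerivAt (fun φ hφ => by
    rw [uIcc_of_le hβ.2.le] at hφ
    exact hasDerivAt_areaPrimitive hb hba r
      (sin_pos_of_pos_of_lt_pi (hβ.1.trans_le hφ.1) (by linarith [hφ.2, pi_pos])).ne')
    (hcont.intervalIntegrable (betaAng a b r) (π / 2))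
  rw [areaPrimitive_betaAng hb hba har hrb, areaPrimitive_pi_div_two,
    intervalIntegral.integral_const_mul] at this
  linarith

end Primitive

section Quarter

lemma setIntegral_image_comp_invFunOn {f f' : ℝ → ℝ} {s : Set ℝ} (hs : MeasurableSet s)
    (hf' : ∀ x ∈ s, HasDerivWithinAt f (f' x) s x) (hf : InjOn f s) (g : ℝ → ℝ) :
    ∫ u in f '' s, g (Function.invFunOn f s u) = ∫ x in s, |f' x| * g x := by
  rw [integral_image_eq_integral_abs_deriv_smul hs hf' hf]
  refine setIntegral_congr_fun hs fun x hx => ?_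
  simp only [smul_eq_mul, hf.leftInvOn_invFunOn hx]

lemma integrableOn_image_comp_invFunOn {f f' : ℝ → ℝ} {s : Set ℝ} (hs : MeasurableSet s)
    (hf' : ∀ x ∈ s, HasDerivWithinAt f (f' x) s x) (hf : InjOn f s) {g : ℝ → ℝ}
    (hg : IntegrableOn (fun x => |f' x| * g x) s) :
    IntegrableOn (fun u => g (Function.invFunOn f s u)) (f '' s) := by
  rw [integrableOn_image_iff_integrableOn_abs_deriv_smul hs hf' hf]
  refine hg.congr_fun (fun x hx => ?_) hs
  simp only [smul_eq_mul, hf.leftInvOn_invFunOn hx]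

variable {a b r κ : ℝ}

/-- The function on `(0, parallelX a b r κ)` whose graph is the part of the inner parallel curve
with parameters in `s`. -/
def parallelGraph (a b r : ℝ) (s : Set ℝ) (u : ℝ) : ℝ :=
  parallelY a b r (Function.invFunOn (parallelX a b r) s u)

lemma parallelGraph_parallelX {s : Set ℝ} (hs : InjOn (parallelX a b r) s) {ψ : ℝ} (hψ : ψ ∈ s) :
    parallelGraph a b r s (parallelX a b r ψ) = parallelY a b r ψ := by
  rw [parallelGraph, hs.leftInvOn_invFunOn hψ]

lemma volume_regionBetween_parallelGraph (hb : 0 < b) (hba : b < a) (har : a < r)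
    (hrb : r * b < a ^ 2) (hκ : κ ∈ Ioo (betaAng a b r) (π / 2))
    (hκr : curvatureRadius a b κ = r) :
    volume (regionBetween (parallelGraph a b r (Ioo (betaAng a b r) κ))
      (parallelGraph a b r (Ioo κ (π / 2))) (Ioo 0 (parallelX a b r κ))) =
      ENNReal.ofReal ((Ffun a b r (betaAng a b r) - Astar a b r) / 4) := by
  have ha := hb.trans hba
  have hβ := betaAng_mem hb hba har hrb
  have hκ' : κ ∈ Ioo 0 (π / 2) := ⟨hβ.1.trans hκ.1, hκ.2⟩
  set β := betaAng a b r
  have hd (s : Set ℝ) : ∀ φ ∈ s, HasDerivWithinAt (parallelX a b r)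
      ((r - curvatureRadius a b φ) * sin φ) s φ :=
    fun φ _ => (hasDerivAt_parallelX ha hb r φ).hasDerivWithinAt
  have hsub : Ioo β κ ⊆ Icc 0 κ := fun x hx => ⟨hβ.1.le.trans hx.1.le, hx.2.le⟩
  have hinj₂ := (strictMonoOn_parallelX hb hba hκ' hκr).injOn.mono hsub
  have hinj₁ := (strictAntiOn_parallelX hb hba hκ' hκr).injOn.mono Ioo_subset_Icc_self
  have him₂ := image_parallelX_left hb hba har hrb hκ hκr
  have him₁ := image_parallelX_right hb hba hκ' hκr
  have hcont : Continuous fun φ => (r - curvatureRadius a b φ) * sin φ * parallelY a b r φ := by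
    have := continuous_curvatureRadius ha hb
    have := continuous_parallelY ha hb r
    fun_prop
  have hcont' : Continuous fun φ => |(r - curvatureRadius a b φ) * sin φ| * parallelY a b r φ := by
    have := continuous_curvatureRadius ha hb
    have := continuous_parallelY ha hb r
    fun_prop
  have hg (c d : ℝ) : IntegrableOn
      (fun φ => |(r - curvatureRadius a b φ) * sin φ| * parallelY a b r φ) (Ioo c d) :=
    (hcont'.integrableOn_Icc).mono_set Ioo_subset_Icc_self
  have hg₂ := integrableOn_image_comp_invFunOn measurableSet_Ioo (hd _) hinj₂ (hg _ _)
  have hg₁ := integrableOn_image_comp_invFunOn measurableSet_Ioo (hd _) hinj₁ (hg _ _)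
  have hI₂ := setIntegral_image_comp_invFunOn measurableSet_Ioo (hd _) hinj₂ (parallelY a b r)
  have hI₁ := setIntegral_image_comp_invFunOn measurableSet_Ioo (hd _) hinj₁ (parallelY a b r)
  rw [him₂] at hg₂ hI₂
  rw [him₁] at hg₁ hI₁
  have hρ := strictMonoOn_curvatureRadius hb hba
  have habs₂ : ∫ φ in Ioo β κ, |(r - curvatureRadius a b φ) * sin φ| * parallelY a b r φ =
      ∫ φ in β..κ, (r - curvatureRadius a b φ) * sin φ * parallelY a b r φ := by
    rw [intervalIntegral.integral_of_le hκ.1.le, integral_Ioc_eq_integral_Ioo]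
    refine setIntegral_congr_fun measurableSet_Ioo fun φ hφ => ?_
    have h1 : φ ∈ Ioo 0 (π / 2) := ⟨hβ.1.trans hφ.1, hφ.2.trans hκ.2⟩
    have h2 : curvatureRadius a b φ < r :=
      hκr ▸ hρ (Ioo_subset_Icc_self h1) (Ioo_subset_Icc_self hκ') hφ.2
    have := sin_pos_of_mem h1
    simp only [abs_of_nonneg (mul_nonneg (sub_nonneg.2 h2.le) this.le)]
  have habs₁ : ∫ φ in Ioo κ (π / 2), |(r - curvatureRadius a b φ) * sin φ| * parallelY a b r φ =
      -∫ φ in κ..π / 2, (r - curvatureRadius a b φ) * sin φ * parallelY a b r φ := by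
    rw [intervalIntegral.integral_of_le hκ.2.le, integral_Ioc_eq_integral_Ioo, ← integral_neg]
    refine setIntegral_congr_fun measurableSet_Ioo fun φ hφ => ?_
    have h1 : φ ∈ Ioo 0 (π / 2) := ⟨hκ'.1.trans hφ.1, hφ.2⟩
    have h2 : r < curvatureRadius a b φ :=
      hκr ▸ hρ (Ioo_subset_Icc_self hκ') (Ioo_subset_Icc_self h1) hφ.1
    have := sin_pos_of_mem h1
    simp only [abs_of_nonpos (mul_nonpos_of_nonpos_of_nonneg (sub_nonpos.2 h2.le) this.le),
      neg_mul]
  rw [Measure.volume_eq_prod,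
    volume_regionBetween_eq_integral (f := parallelGraph a b r (Ioo β κ))
      (g := parallelGraph a b r (Ioo κ (π / 2))) hg₂ hg₁ measurableSet_Ioo]
  · congr 1
    simp only [Pi.sub_apply, parallelGraph]
    rw [integral_sub hg₁ hg₂, hI₁, hI₂, habs₁, habs₂]
    have hadd := intervalIntegral.integral_add_adjacent_intervals (μ := volume)
      (hcont.intervalIntegrable β κ) (hcont.intervalIntegrable κ (π / 2))
    have := integral_parallelX_deriv_mul_parallelY hb hba har hrb
    linarith
  · intro u hu
    obtain ⟨ψ₂, hψ₂, e₂⟩ := him₂ ▸ hu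
    obtain ⟨ψ₁, hψ₁, e₁⟩ := him₁ ▸ hu
    have := (parallelY_lt_parallelY hb hba har hrb hκ hκr hu.1 hψ₂ hψ₁ e₂ e₁).le
    rwa [← parallelGraph_parallelX hinj₂ hψ₂, ← parallelGraph_parallelX hinj₁ hψ₁, e₁, e₂] at this

lemma ncard_sphere_inter_Cset_eq_four_iff (hb : 0 < b) (hba : b < a) (har : a < r)
    (hrb : r * b < a ^ 2) (hκ : κ ∈ Ioo (betaAng a b r) (π / 2))
    (hκr : curvatureRadius a b κ = r) {x : E2} (hx₀ : 0 < x 0) (hx₁ : 0 < x 1) :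
    (sphere x r ∩ Cset a b).ncard = 4 ↔
      ∃ ψ₂ ∈ Ioo (betaAng a b r) κ, ∃ ψ₁ ∈ Ioo κ (π / 2),
        parallelX a b r ψ₂ = x 0 ∧ parallelX a b r ψ₁ = x 0 ∧
        parallelY a b r ψ₂ < x 1 ∧ x 1 < parallelY a b r ψ₁ := by
  have ha := hb.trans hba
  have hr := ha.trans har
  rw [← exists_centerHeight_iff hb hba har hrb hκ hκr hx₀,
    ← exists_neg_pos_iff_centerHeight ha hb hx₁]
  constructor
  · intro h
    exact exists_neg_pos_of_ncard_eq_four hb hba hx₀ hx₁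
      fun α => by rw [← ncard_sphere_inter_Cset ha hb hr, h]
  · rintro ⟨t₁, t₂, h₁, h₁₂, h₂, hD₁, hD₂⟩
    rw [ncard_sphere_inter_Cset ha hb hr,
      ncard_eq_four_of_exists_neg_pos hb hba hx₀ hx₁ h₁ h₁₂ h₂ hD₁ hD₂]

lemma mem_regionBetween_parallelGraph_iff (hb : 0 < b) (hba : b < a) (har : a < r)
    (hrb : r * b < a ^ 2) (hκ : κ ∈ Ioo (betaAng a b r) (π / 2))
    (hκr : curvatureRadius a b κ = r) (x : E2) :
    (x 0, x 1) ∈ regionBetween (parallelGraph a b r (Ioo (betaAng a b r) κ))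
      (parallelGraph a b r (Ioo κ (π / 2))) (Ioo 0 (parallelX a b r κ)) ↔
      (0 < x 0 ∧ 0 < x 1) ∧ (sphere x r ∩ Cset a b).ncard = 4 := by
  have hβ := betaAng_mem hb hba har hrb
  have hκ' : κ ∈ Ioo 0 (π / 2) := ⟨hβ.1.trans hκ.1, hκ.2⟩
  have hsub : Ioo (betaAng a b r) κ ⊆ Icc 0 κ := fun x hx => ⟨hβ.1.le.trans hx.1.le, hx.2.le⟩
  have hinj₂ := (strictMonoOn_parallelX hb hba hκ' hκr).injOn.mono hsub
  have hinj₁ := (strictAntiOn_parallelX hb hba hκ' hκr).injOn.mono Ioo_subset_Icc_self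
  have him₂ := image_parallelX_left hb hba har hrb hκ hκr
  have him₁ := image_parallelX_right hb hba hκ' hκr
  constructor
  · rintro ⟨hu, hy⟩
    obtain ⟨ψ₂, hψ₂, e₂⟩ := him₂ ▸ hu
    obtain ⟨ψ₁, hψ₁, e₁⟩ := him₁ ▸ hu
    simp only at hu hy e₁ e₂
    rw [mem_Ioo, ← e₂, parallelGraph_parallelX hinj₂ hψ₂, e₂, ← e₁,
      parallelGraph_parallelX hinj₁ hψ₁] at hy
    have hx₁ := (parallelY_pos hb hba har ⟨hβ.1.trans hψ₂.1, hψ₂.2.trans hκ.2⟩).trans hy.1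
    exact ⟨⟨hu.1, hx₁⟩, (ncard_sphere_inter_Cset_eq_four_iff hb hba har hrb hκ hκr hu.1 hx₁).2
      ⟨ψ₂, hψ₂, ψ₁, hψ₁, e₂, e₁, hy⟩⟩
  · rintro ⟨⟨hx₀, hx₁⟩, h⟩
    obtain ⟨ψ₂, hψ₂, ψ₁, hψ₁, e₂, e₁, hy⟩ :=
      (ncard_sphere_inter_Cset_eq_four_iff hb hba har hrb hκ hκr hx₀ hx₁).1 h
    refine ⟨?_, ?_⟩
    · rw [← him₂]
      exact ⟨ψ₂, hψ₂, e₂⟩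
    · rwa [← parallelGraph_parallelX hinj₂ hψ₂, ← parallelGraph_parallelX hinj₁ hψ₁, e₁, e₂] at hy

lemma measurePreserving_coords :
    MeasurePreserving (fun x : E2 => (x 0, x 1)) :=
  (volume_preserving_finTwoArrow ℝ).comp (PiLp.volume_preserving_ofLp (Fin 2))

lemma measurableEmbedding_coords : MeasurableEmbedding (fun x : E2 => (x 0, x 1)) :=
  (MeasurableEquiv.finTwoArrow).measurableEmbedding.comp
    (MeasurableEquiv.toLp 2 (Fin 2 → ℝ)).symm.measurableEmbedding

lemma volume_quarter (hb : 0 < b) (hba : b < a) (har : a < r) (hrb : r * b < a ^ 2) :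
    volume {x : E2 | (0 < x 0 ∧ 0 < x 1) ∧ (sphere x r ∩ Cset a b).ncard = 4} =
      ENNReal.ofReal ((Ffun a b r (betaAng a b r) - Astar a b r) / 4) := by
  obtain ⟨κ, hκ, hκr⟩ := exists_cusp hb hba har hrb
  rw [← volume_regionBetween_parallelGraph hb hba har hrb hκ hκr,
    ← measurePreserving_coords.measure_preimage_emb measurableEmbedding_coords]
  congr 1
  ext x
  exact (mem_regionBetween_parallelGraph_iff hb hba har hrb hκ hκr x).symm

end Quarter

section Symmetry

/-- The reflection of the plane that changes the sign of the `j`-th coordinate. -/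
def coordReflection (j : Fin 2) : E2 ≃ₗᵢ[ℝ] E2 :=
  LinearIsometryEquiv.piLpCongrRight 2
    fun i => if i = j then LinearIsometryEquiv.neg ℝ else LinearIsometryEquiv.refl ℝ ℝ

lemma coordReflection_apply (j i : Fin 2) (x : E2) :
    coordReflection j x i = if i = j then -x i else x i := by
  simp only [coordReflection, LinearIsometryEquiv.piLpCongrRight_apply]
  split_ifs <;> rfl

lemma coordReflection_mem_Cset_iff (a b : ℝ) (j : Fin 2) (x : E2) :
    coordReflection j x ∈ Cset a b ↔ x ∈ Cset a b := by
  have h (i : Fin 2) : coordReflection j x i ^ 2 = x i ^ 2 := by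
    rw [coordReflection_apply]
    split_ifs <;> simp
  simp only [Cset, mem_ofPred_eq, h]

lemma ncard_sphere_coordReflection_inter_Cset (a b r : ℝ) (j : Fin 2) (x : E2) :
    (sphere (coordReflection j x) r ∩ Cset a b).ncard = (sphere x r ∩ Cset a b).ncard := by
  rw [← ncard_preimage_of_injective_subset_range (coordReflection j).injective
    (by rw [(coordReflection j).surjective.range_eq]; exact subset_univ _), preimage_inter,
    (coordReflection j).isometry.preimage_sphere]
  congr 2
  ext y
  exact coordReflection_mem_Cset_iff a b j y

lemma volume_setOf_coord_eq_zero (j : Fin 2) : volume {x : E2 | x j = 0} = 0 := by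
  have := (PiLp.volume_preserving_ofLp (Fin 2)).measure_preimage_emb
    (MeasurableEquiv.toLp 2 (Fin 2 → ℝ)).symm.measurableEmbedding {f | f j = 0}
  exact this.trans (Measure.pi_hyperplane (fun _ => volume) j 0)

lemma volume_eq_two_mul_of_coordReflection_symm (j : Fin 2) {W : Set E2}
    (hW : ∀ x, coordReflection j x ∈ W ↔ x ∈ W) :
    volume W = 2 * volume (W ∩ {x | 0 < x j}) := by
  have hP : MeasurableSet {x : E2 | 0 < x j} := measurableSet_lt (by fun_prop) (by fun_prop)
  have hpre : coordReflection j ⁻¹' (W ∩ {x | 0 < x j}) = W ∩ {x | x j < 0} := by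
    ext x
    simp [hW, coordReflection_apply]
  have hneg : volume (W ∩ {x | x j < 0}) = volume (W ∩ {x | 0 < x j}) := by
    rw [← hpre]
    exact (coordReflection j).measurePreserving.measure_preimage_emb
      (coordReflection j).toHomeomorph.measurableEmbedding _
  have hdiff : volume (W \ {x | 0 < x j}) = volume (W ∩ {x | x j < 0}) := by
    refine le_antisymm ?_ (measure_mono fun x hx => ⟨hx.1, fun h : 0 < x j => h.not_gt hx.2⟩)
    calc volume (W \ {x | 0 < x j})
        ≤ volume ((W ∩ {x | x j < 0}) ∪ {x | x j = 0}) := by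
          refine measure_mono fun x hx => ?_
          rcases (not_lt.1 hx.2 : x j ≤ 0).lt_or_eq with h | h
          · exact Or.inl ⟨hx.1, h⟩
          · exact Or.inr h
      _ ≤ volume (W ∩ {x | x j < 0}) :=
          (measure_union_le _ _).trans (by rw [volume_setOf_coord_eq_zero, add_zero])
  rw [← measure_inter_add_sdiff W hP, hdiff, hneg, two_mul]

end Symmetry

/-- Case 4 of Lemma 1: for `a < r < a²/b`, the area of the set of centers `x` for which the
circle of radius `r` about `x` meets the ellipse in exactly four points is `F(β) − A*`. -/
theorem area_four_intersections_case4 (a b r : ℝ) (hb : 0 < b) (hba : b < a)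
    (hr1 : a < r) (hr2 : r < a^2 / b) :
    volume {x : E2 | (sphere x r ∩ Cset a b).ncard = 4} =
      ENNReal.ofReal (Ffun a b r (betaAng a b r) - Astar a b r) := by
  have hrb : r * b < a ^ 2 := (lt_div_iff₀ hb).1 hr2
  rw [volume_eq_two_mul_of_coordReflection_symm 0 fun x => by
      simp only [mem_ofPred_eq, ncard_sphere_coordReflection_inter_Cset],
    volume_eq_two_mul_of_coordReflection_symm 1 fun x => by
      simp [ncard_sphere_coordReflection_inter_Cset, coordReflection_apply]]
  have hquarter : {x : E2 | (sphere x r ∩ Cset a b).ncard = 4} ∩ {x | 0 < x 0} ∩ {x | 0 < x 1} =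
      {x : E2 | (0 < x 0 ∧ 0 < x 1) ∧ (sphere x r ∩ Cset a b).ncard = 4} := by
    ext x
    simp only [mem_inter_iff, mem_ofPred_eq]
    tauto
  rw [hquarter, volume_quarter hb hba hr1 hrb, ← mul_assoc]
  have h4 : (2 * 2 : ENNReal) = ENNReal.ofReal 4 := by norm_num
  rw [h4, ← ENNReal.ofReal_mul (by norm_num)]
  congr 1
  ring
end
end

section
/- Let a ≥ b > 0 and r ≥ a²/b. Then the area of the set {x ∈ ℝ² : K(a,b) ⊆ closedBall(x,r)} equals πr² + πab − 4raE(ε), where ε = √(a²−b²)/a and E(ε) = ∫₀^{π/2} √(1−ε² sin²θ) dθ. -/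
open Real MeasureTheory Set Metric

noncomputable section

/-- Support function of the ellipse with semi-axes `a`, `b` in the direction of angle `φ`. -/
def ellipseSupport (a b φ : ℝ) : ℝ := √(a^2 * cos φ^2 + b^2 * sin φ^2)

lemma ellipseSupport_radicand_pos {a b : ℝ} (ha : 0 < a) (hb : 0 < b) (φ : ℝ) :
    0 < a^2 * cos φ^2 + b^2 * sin φ^2 := by
  by_cases h : sin φ = 0
  · have := sin_sq_add_cos_sq φ
    rw [h] at this ⊢
    have h2 : cos φ^2 = 1 := by linarith
    rw [h2]; positivity
  · positivity

lemma ellipseSupport_pos {a b : ℝ} (ha : 0 < a) (hb : 0 < b) (φ : ℝ) :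
    0 < ellipseSupport a b φ :=
  sqrt_pos.2 (ellipseSupport_radicand_pos ha hb φ)

lemma ellipseSupport_sq (a b φ : ℝ) :
    ellipseSupport a b φ^2 = a^2 * cos φ^2 + b^2 * sin φ^2 :=
  sq_sqrt (by positivity)

lemma le_ellipseSupport {a b : ℝ} (hb : 0 < b) (hab : b ≤ a) (φ : ℝ) :
    b ≤ ellipseSupport a b φ := by
  apply le_sqrt_of_sq_le
  have := sin_sq_add_cos_sq φ
  have : b^2 ≤ a^2 := by gcongr
  nlinarith [sq_nonneg (cos φ)]

@[fun_prop]
lemma continuous_ellipseSupport (a b : ℝ) : Continuous (ellipseSupport a b) := by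
  unfold ellipseSupport; fun_prop

lemma hasDerivAt_ellipseSupport {a b : ℝ} (ha : 0 < a) (hb : 0 < b) (φ : ℝ) :
    HasDerivAt (ellipseSupport a b)
      ((b^2 - a^2) * (sin φ * cos φ) / ellipseSupport a b φ) φ := by
  have h := ((((hasDerivAt_cos φ).pow 2).const_mul (a^2)).add
    (((hasDerivAt_sin φ).pow 2).const_mul (b^2))).sqrt (ellipseSupport_radicand_pos ha hb φ).ne'
  refine h.congr_deriv ?_
  have := (ellipseSupport_pos ha hb φ).ne'
  change _ / (2 * ellipseSupport a b φ) = _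
  field_simp
  simp
  ring

lemma hasDerivAt_cos_div_ellipseSupport {a b : ℝ} (ha : 0 < a) (hb : 0 < b) (φ : ℝ) :
    HasDerivAt (fun φ => cos φ / ellipseSupport a b φ)
      (-(b^2 * sin φ / ellipseSupport a b φ^3)) φ := by
  have h0 := (ellipseSupport_pos ha hb φ).ne'
  refine ((hasDerivAt_cos φ).div (hasDerivAt_ellipseSupport ha hb φ) h0).congr_deriv ?_
  field_simp
  rw [ellipseSupport_sq]
  linear_combination (-sin φ * b^2) * sin_sq_add_cos_sq φ

/-- Antiderivative of `ab / h²`, with `h` the support function of the ellipse. -/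
lemma hasDerivAt_add_arctan {a b : ℝ} (ha : 0 < a) (hb : 0 < b) (φ : ℝ) :
    HasDerivAt
      (fun φ => φ + arctan ((b - a) * (sin φ * cos φ) / (a * cos φ^2 + b * sin φ^2)))
      (a * b / ellipseSupport a b φ^2) φ := by
  have hd : a * cos φ^2 + b * sin φ^2 ≠ 0 := by
    have := ellipseSupport_radicand_pos (sqrt_pos.2 ha) (sqrt_pos.2 hb) φ
    rw [sq_sqrt ha.le, sq_sqrt hb.le] at this
    exact this.ne'
  have h := (hasDerivAt_id φ).add (((((hasDerivAt_sin φ).mul (hasDerivAt_cos φ)).const_mul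
    (b - a)).div ((((hasDerivAt_cos φ).pow 2).const_mul a).add
    (((hasDerivAt_sin φ).pow 2).const_mul b)) hd).arctan)
  refine h.congr_deriv ?_
  have hs := ellipseSupport_sq a b φ
  have h0 := (ellipseSupport_pos ha hb φ).ne'
  have key : 1 + ((b - a) * (sin φ * cos φ) / (a * cos φ^2 + b * sin φ^2))^2
      = ellipseSupport a b φ^2 / (a * cos φ^2 + b * sin φ^2)^2 := by
    field_simp
    rw [hs]
    linear_combination (a^2 * cos φ^2 + b^2 * sin φ^2) * sin_sq_add_cos_sq φ
  simp only [Pi.add_apply, Pi.mul_apply, Pi.div_apply, Pi.pow_apply]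
  rw [key]
  field_simp
  simp only [Nat.cast_ofNat, Nat.add_one_sub_one, pow_one]
  rw [hs]
  linear_combination ((b - a) * (a * cos φ^2 - b * sin φ^2) + a * b) * sin_sq_add_cos_sq φ

lemma integral_ellipseSupport {a b : ℝ} (hb : 0 < b) (hab : b ≤ a) :
    ∫ φ in (0 : ℝ)..π, ellipseSupport a b φ = 2 * a * Ecomp (ecc a b) := by
  have ha : 0 < a := hb.trans_le hab
  have hi : ∀ u v, IntervalIntegrable (ellipseSupport a b) volume u v := fun u v =>
    (continuous_ellipseSupport a b).intervalIntegrable u v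
  have hsymm : ∫ φ in (π / 2)..π, ellipseSupport a b φ
      = ∫ φ in (0 : ℝ)..(π / 2), ellipseSupport a b φ := by
    have h := intervalIntegral.integral_comp_sub_left (a := 0) (b := π / 2)
      (ellipseSupport a b) π
    rw [sub_zero, sub_half] at h
    rw [← h]
    simp [ellipseSupport]
  have hquarter : ∫ φ in (0 : ℝ)..(π / 2), ellipseSupport a b φ = a * Ecomp (ecc a b) := by
    rw [Ecomp, Einc, ← intervalIntegral.integral_const_mul]
    congr 1
    ext φ
    have hab2 : b^2 ≤ a^2 := by gcongr
    rw [ellipseSupport, ecc, div_pow, sq_sqrt (by linarith)]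
    nth_rw 2 [← sqrt_sq ha.le]
    rw [← sqrt_mul (sq_nonneg a)]
    congr 1
    field_simp
    linear_combination a^2 * sin_sq_add_cos_sq φ
  rw [← intervalIntegral.integral_add_adjacent_intervals (hi 0 (π / 2)) (hi (π / 2) π), hsymm,
    hquarter]
  ring

lemma integral_inner_parallel {a b : ℝ} (r : ℝ) (hb : 0 < b) (hab : b ≤ a) :
    ∫ φ in (0 : ℝ)..π, (sin φ * (r - a^2 * b^2 / ellipseSupport a b φ^3)) *
        (2 * (sin φ * (r - b^2 / ellipseSupport a b φ)))
      = π * r^2 + π * a * b - 4 * r * a * Ecomp (ecc a b) := by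
  have ha : 0 < a := hb.trans_le hab
  set h := ellipseSupport a b with hh
  have h0 : ∀ φ, h φ ≠ 0 := fun φ => (ellipseSupport_pos ha hb φ).ne'
  have hcont : Continuous h := continuous_ellipseSupport a b
  have hc1 : Continuous fun φ => (sin φ * (r - a^2 * b^2 / h φ^3)) *
      (2 * (sin φ * (r - b^2 / h φ))) := by
    fun_prop (disch := simp [h0])
  have hc2 : Continuous fun φ => 2 * r * h φ := continuous_const.mul hcont
  have hderiv : ∀ φ, HasDerivAt (fun φ => r^2 * (φ - sin φ * cos φ)
      + 2 * r * a^2 * (sin φ * (cos φ / h φ))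
      + a * b * (φ + arctan ((b - a) * (sin φ * cos φ) / (a * cos φ^2 + b * sin φ^2)))
      - a^2 * b^2 * ((sin φ / h φ) * (cos φ / h φ)))
      ((sin φ * (r - a^2 * b^2 / h φ^3)) * (2 * (sin φ * (r - b^2 / h φ))) + 2 * r * h φ)
      φ := by
    intro φ
    have d1 := hasDerivAt_cos_div_ellipseSupport ha hb φ
    have d2 := hasDerivAt_add_arctan ha hb φ
    have d3 := hasDerivAt_ellipseSupport ha hb φ
    rw [← hh] at d1 d2 d3
    refine ((((((hasDerivAt_id φ).sub ((hasDerivAt_sin φ).mul (hasDerivAt_cos φ))).const_mul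
      (r^2)).add (((hasDerivAt_sin φ).mul d1).const_mul (2 * r * a^2))).add
      (d2.const_mul (a * b))).sub ((((hasDerivAt_sin φ).div d3 (h0 φ)).mul d1).const_mul
      (a^2 * b^2))).congr_deriv ?_
    have hs : h φ^2 = a^2 * cos φ^2 + b^2 * sin φ^2 := ellipseSupport_sq a b φ
    have := h0 φ
    simp only [Pi.div_apply]
    field_simp
    linear_combination (-r^2 * h φ^4 - a^2 * b^2 * h φ^2 + a^2 * b^4 * sin φ^2) *
      sin_sq_add_cos_sq φ + (-2 * r * h φ^3 + a^2 * b^2 * sin φ^2) * hs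
  have hint := intervalIntegral.integral_eq_sub_of_hasDerivAt (a := 0) (b := π)
    (fun φ _ => hderiv φ)
    ((hc1.add hc2).intervalIntegrable 0 π)
  rw [intervalIntegral.integral_add (hc1.intervalIntegrable 0 π)
    (hc2.intervalIntegrable 0 π), intervalIntegral.integral_const_mul,
    integral_ellipseSupport hb hab] at hint
  simp only [sin_pi, sin_zero, zero_mul, mul_zero, zero_div, arctan_zero, sub_zero, add_zero]
    at hint
  linear_combination hint

/-- Coordinate form of the set of centers of balls of radius `r` containing an ellipse. -/
def ballCenters (a b r : ℝ) : Set (ℝ × ℝ) :=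
  {q | ∀ k : ℝ × ℝ, k.1^2 / a^2 + k.2^2 / b^2 ≤ 1 → (k.1 - q.1)^2 + (k.2 - q.2)^2 ≤ r^2}

lemma isClosed_ballCenters (a b r : ℝ) : IsClosed (ballCenters a b r) := by
  simp only [ballCenters, ofPred_forall]
  exact isClosed_iInter fun k => isClosed_iInter fun _ =>
    isClosed_le (by fun_prop) continuous_const

lemma volume_subset_closedBall (a b : ℝ) {r : ℝ} (hr : 0 ≤ r) :
    volume {x : E2 | Kset a b ⊆ closedBall x r} = volume (ballCenters a b r) := by
  have hmp := (volume_preserving_finTwoArrow ℝ).comp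
    (EuclideanSpace.volume_preserving_symm_measurableEquiv_toLp (Fin 2))
  rw [← hmp.measure_preimage (isClosed_ballCenters a b r).measurableSet.nullMeasurableSet]
  congr 1
  ext x
  have hdist : ∀ k : E2, dist k x ≤ r ↔ (k 0 - x 0)^2 + (k 1 - x 1)^2 ≤ r^2 := by
    intro k
    rw [EuclideanSpace.dist_eq, sqrt_le_left hr]
    simp [Fin.sum_univ_two, dist_eq, sq_abs]
  constructor
  · rintro h ⟨k, l⟩ hk
    have := (hdist !₂[k, l]).1 (h (by simpa [Kset] using hk))
    simpa using this
  · intro h k hk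
    exact (hdist k).2 (h (k 0, k 1) hk)

/-- The ellipse rolls freely inside a disk of radius `r ≥ a² / b`. -/
lemma inner_parallel_mem_ballCenters {a b r : ℝ} (hb : 0 < b) (hab : b ≤ a)
    (hr : a^2 / b ≤ r) (φ : ℝ) :
    (cos φ * (r - a^2 / ellipseSupport a b φ), sin φ * (r - b^2 / ellipseSupport a b φ))
      ∈ ballCenters a b r := by
  have ha : 0 < a := hb.trans_le hab
  rintro ⟨k, l⟩ hk
  have hs := ellipseSupport_sq a b φ
  have hbh := le_ellipseSupport hb hab φ
  have hpos := ellipseSupport_pos ha hb φ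
  have hsc := sin_sq_add_cos_sq φ
  set h := ellipseSupport a b φ
  simp only at hk ⊢
  set c := cos φ
  set s := sin φ
  set u := a^2 * c / h + k with hu
  set v := b^2 * s / h + l with hv
  have h1 : u^2 / a^2 + v^2 / b^2 ≤ 2 * (c * u + s * v) / h := by
    have e : 2 * (c * u + s * v) / h - (u^2 / a^2 + v^2 / b^2)
        = (a^2 * c^2 + b^2 * s^2) / h^2 - (k^2 / a^2 + l^2 / b^2) := by
      rw [hu, hv]; field_simp; ring
    rw [← hs, div_self (by positivity)] at e
    linarith
  have h2 : u^2 + v^2 ≤ a^2 * (u^2 / a^2 + v^2 / b^2) := by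
    have : 1 * v^2 ≤ (a^2 / b^2) * v^2 := by
      gcongr
      rw [one_le_div (by positivity)]; gcongr
    have e : a^2 * (u^2 / a^2 + v^2 / b^2) = u^2 + (a^2 / b^2) * v^2 := by field_simp
    linarith
  have hrh : a^2 ≤ r * h := by
    rw [div_le_iff₀ hb] at hr
    have : 0 ≤ r := by by_contra! hn; nlinarith
    nlinarith
  have h3 : a^2 * (u^2 / a^2 + v^2 / b^2) ≤ r * h * (2 * (c * u + s * v) / h) := by
    gcongr
    have : 0 < a^2 := by positivity
    linarith
  have h4 : r * h * (2 * (c * u + s * v) / h) = 2 * r * (c * u + s * v) := by field_simp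
  have e1 : k - c * (r - a^2 / h) = u - r * c := by rw [hu]; ring
  have e2 : l - s * (r - b^2 / h) = v - r * s := by rw [hv]; ring
  rw [e1, e2]
  nlinarith

lemma ballCenters_slice {a b r : ℝ} (hb : 0 < b) (hab : b ≤ a)
    (hr : a^2 / b ≤ r) {φ : ℝ} (hφ : φ ∈ Icc 0 π) :
    Prod.mk (cos φ * (r - a^2 / ellipseSupport a b φ)) ⁻¹' ballCenters a b r
      = Icc (-(sin φ * (r - b^2 / ellipseSupport a b φ)))
          (sin φ * (r - b^2 / ellipseSupport a b φ)) := by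
  have ha : 0 < a := hb.trans_le hab
  have hr0 : 0 ≤ r := le_trans (by positivity) hr
  have hs0 : 0 ≤ sin φ := sin_nonneg_of_mem_Icc hφ
  have hs := ellipseSupport_sq a b φ
  have hpos := ellipseSupport_pos ha hb φ
  have hmem := inner_parallel_mem_ballCenters hb hab hr φ
  have hsc := sin_sq_add_cos_sq φ
  set h := ellipseSupport a b φ
  set c := cos φ
  set s := sin φ
  have hc : (r * c)^2 = r^2 - (r * s)^2 := by linear_combination r^2 * hsc
  ext y
  constructor
  · intro hy
    have hk1 : (-(a^2 * c / h))^2 / a^2 + (-(b^2 * s / h))^2 / b^2 ≤ 1 := by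
      refine le_of_eq ?_
      field_simp
      linarith
    have hk2 : (-(a^2 * c / h))^2 / a^2 + (b^2 * s / h)^2 / b^2 ≤ 1 := by
      simpa only [neg_sq] using hk1
    have g1 := hy (_, _) hk1
    have g2 := hy (_, _) hk2
    simp only at g1 g2
    have e : -(a^2 * c / h) - c * (r - a^2 / h) = -(r * c) := by ring
    rw [e, neg_sq, hc] at g1 g2
    have f1 := (abs_le_of_sq_le_sq' (show (-(b^2 * s / h) - y)^2 ≤ (r * s)^2 by linarith)
      (by positivity)).1
    have f2 := (abs_le_of_sq_le_sq' (show (b^2 * s / h - y)^2 ≤ (r * s)^2 by linarith)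
      (by positivity)).2
    have e2 : s * (r - b^2 / h) = r * s - b^2 * s / h := by ring
    rw [e2]
    constructor <;> linarith
  · rintro ⟨hy1, hy2⟩ ⟨k, l⟩ hk
    have g1 := hmem (k, l) hk
    have g2 := hmem (k, -l) (by simpa using hk)
    simp only at g1 g2 ⊢
    set x := c * (r - a^2 / h)
    set z := s * (r - b^2 / h)
    have : (l - y)^2 ≤ (l - z)^2 ∨ (l - y)^2 ≤ (-l - z)^2 := by
      rcases le_total l 0 with hl | hl
      · left; nlinarith
      · right; nlinarith
    rcases this with h | h <;> linarith

lemma ballCenters_slice_eq_empty {a b r x : ℝ} (ha : 0 < a) (hr : 0 ≤ r)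
    (hx : x ∉ Icc (-(r - a)) (r - a)) :
    Prod.mk x ⁻¹' ballCenters a b r = ∅ := by
  refine eq_empty_of_forall_notMem fun y hy => hx ?_
  have g1 := hy (a, 0) (by simp [ha.ne'])
  have g2 := hy (-a, 0) (by simp [ha.ne'])
  simp only at g1 g2
  have f1 := abs_le_of_sq_le_sq' (show (a - x)^2 ≤ r^2 by nlinarith) hr
  have f2 := abs_le_of_sq_le_sq' (show (-a - x)^2 ≤ r^2 by nlinarith) hr
  constructor <;> linarith [f1.1, f1.2, f2.1, f2.2]

lemma volume_ballCenters {a b r : ℝ} (hb : 0 < b) (hab : b ≤ a) (hr : a^2 / b ≤ r) :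
    volume (ballCenters a b r) =
      ENNReal.ofReal (∫ φ in (0 : ℝ)..π, (sin φ * (r - a^2 * b^2 / ellipseSupport a b φ^3)) *
        (2 * (sin φ * (r - b^2 / ellipseSupport a b φ)))) := by
  have ha : 0 < a := hb.trans_le hab
  have har : a ≤ r := le_trans (by rw [le_div_iff₀ hb]; nlinarith) hr
  have hr0 : 0 ≤ r := ha.le.trans har
  set h := ellipseSupport a b with hh
  have hpos : ∀ φ, 0 < h φ := ellipseSupport_pos ha hb
  have h0 : ∀ φ, h φ ≠ 0 := fun φ => (hpos φ).ne'
  have hbh : ∀ φ, b ≤ h φ := le_ellipseSupport hb hab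
  have hcont : Continuous h := continuous_ellipseSupport a b
  have hp1 : ∀ φ ∈ Icc 0 π, 0 ≤ sin φ * (r - a^2 * b^2 / h φ^3) := by
    intro φ hφ
    refine mul_nonneg (sin_nonneg_of_mem_Icc hφ) (sub_nonneg.2 (le_trans ?_ hr))
    calc a^2 * b^2 / h φ^3 ≤ a^2 * b^2 / b^3 := by gcongr; exact hbh φ
      _ = a^2 / b := by field_simp
  have hp2 : ∀ φ ∈ Icc 0 π, 0 ≤ sin φ * (r - b^2 / h φ) := by
    intro φ hφ
    refine mul_nonneg (sin_nonneg_of_mem_Icc hφ) (sub_nonneg.2 (le_trans ?_ har))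
    calc b^2 / h φ ≤ b^2 / b := by gcongr; exact hbh φ
      _ = b := by field_simp
      _ ≤ a := hab
  set X : ℝ → ℝ := fun φ => cos φ * (r - a^2 / h φ) with hX
  have hXd : ∀ φ, HasDerivAt X (-(sin φ * (r - a^2 * b^2 / h φ^3))) φ := by
    intro φ
    have e : X = fun φ => r * cos φ - a^2 * (cos φ / h φ) := by
      ext φ; simp only [hX]; ring
    rw [e]
    refine (((hasDerivAt_cos φ).const_mul r).sub
      ((hasDerivAt_cos_div_ellipseSupport ha hb φ).const_mul (a^2))).congr_deriv ?_
    rw [← hh]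
    ring
  have hXc : Continuous X := continuous_iff_continuousAt.2 fun φ => (hXd φ).continuousAt
  have hanti : AntitoneOn X (Icc 0 π) :=
    antitoneOn_of_hasDerivWithinAt_nonpos (convex_Icc 0 π) hXc.continuousOn
      (fun φ _ => (hXd φ).hasDerivWithinAt)
      (fun φ hφ => neg_nonpos.2 (hp1 φ (interior_subset hφ)))
  have himg : Icc (-(r - a)) (r - a) ⊆ X '' Icc 0 π := by
    have e0 : X 0 = r - a := by
      simp only [hX, hh, ellipseSupport, cos_zero, sin_zero]
      have : √(a^2 * 1^2 + b^2 * 0^2) = a := by simp [ha.le]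
      rw [this]; field_simp
    have e1 : X π = -(r - a) := by
      simp only [hX, hh, ellipseSupport, cos_pi, sin_pi]
      have : √(a^2 * (-1)^2 + b^2 * 0^2) = a := by simp [ha.le]
      rw [this]; field_simp
    rw [← e0, show -(X 0) = X π by rw [e0, e1]]
    exact intermediate_value_Icc' pi_pos.le hXc.continuousOn
  have hint : Continuous fun φ => (sin φ * (r - a^2 * b^2 / h φ^3)) *
      (2 * (sin φ * (r - b^2 / h φ))) := by
    fun_prop (disch := simp [h0])
  rw [Measure.volume_eq_prod, Measure.prod_apply (isClosed_ballCenters a b r).measurableSet,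
    ← setLIntegral_eq_of_support_subset
      (Function.support_subset_iff'.2 fun x hx => ?_),
    lintegral_image_eq_lintegral_deriv_mul_of_antitoneOn measurableSet_Icc
      (fun φ _ => (hXd φ).hasDerivWithinAt) hanti,
    intervalIntegral.integral_of_le pi_pos.le, ← integral_Icc_eq_integral_Ioc,
    ofReal_integral_eq_lintegral_ofReal (hint.integrableOn_Icc)]
  · refine setLIntegral_congr_fun measurableSet_Icc fun φ hφ => ?_
    simp only [neg_neg]
    rw [ballCenters_slice hb hab hr hφ, volume_Icc, ← ENNReal.ofReal_mul (hp1 φ hφ)]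
    congr 2
    ring
  · refine (ae_restrict_iff' measurableSet_Icc).2 (ae_of_all _ fun φ hφ => ?_)
    exact mul_nonneg (hp1 φ hφ) (mul_nonneg two_pos.le (hp2 φ hφ))
  · rw [ballCenters_slice_eq_empty ha hr0 (fun hx' => hx (himg hx')), measure_empty]

/-- Case 5 of Lemma 1: for `r ≥ a²/b`, the area of the set of centers `x` with
`K(a,b) ⊆ closedBall x r` is `πr² + πab − 4raE(ε)`. -/
theorem area_ellipse_subset_ball_case5 (a b r : ℝ) (hb : 0 < b) (hab : b ≤ a)
    (hr : a^2 / b ≤ r) :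
    volume {x : E2 | Kset a b ⊆ closedBall x r} =
      ENNReal.ofReal (π * r^2 + π * a * b - 4 * r * a * Ecomp (ecc a b)) := by
  have ha : 0 < a := hb.trans_le hab
  rw [volume_subset_closedBall a b (le_trans (by positivity) hr), volume_ballCenters hb hab hr,
    integral_inner_parallel r hb hab]
end
end

section
/- For all a ≥ b > 0 and all r > 0, one has 2·(area of {x ∈ ℝ² : (sphere(x,r) ∩ C(a,b)) has cardinality 2}) + 4·(area of {x ∈ ℝ² : (sphere(x,r) ∩ C(a,b)) has cardinality 4}) = 16raE(ε), where ε = √(a²−b²)/a and E(ε) = ∫₀^{π/2} √(1−ε² sin²θ) dθ. -/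
open Real MeasureTheory Set Metric

noncomputable section

open Topology in
theorem exists_measurable_partition_injOn {E : Type*} [NormedAddCommGroup E] [NormedSpace ℝ E]
    [FiniteDimensional ℝ E] [MeasurableSpace E] [BorelSpace E]
    {f : E → E} {f' : E → E →L[ℝ] E} {U : Set E} (hU : IsOpen U)
    (hf : ∀ x ∈ U, HasStrictFDerivAt f (f' x) x) (hdet : ∀ x ∈ U, (f' x).det ≠ 0) :
    ∃ A : ℕ → Set E, (∀ n, MeasurableSet (A n)) ∧ Pairwise (Function.onFun Disjoint A) ∧
      (⋃ n, A n) = U ∧ ∀ n, InjOn f (A n) := by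
  have : CompleteSpace E := FiniteDimensional.complete ℝ E
  have hloc : ∀ x ∈ U, ∃ V : Set E, V ∈ 𝓝 x ∧ IsOpen V ∧ V ⊆ U ∧ InjOn f V := by
    intro x hx
    have h : HasStrictFDerivAt f
        (((f' x).toContinuousLinearEquivOfDetNeZero (hdet x hx) : E ≃L[ℝ] E) : E →L[ℝ] E) x := by
      simpa using hf x hx
    obtain ⟨V, hV, hVo, hinj⟩ : ∃ V : Set E, V ∈ 𝓝 x ∧ IsOpen V ∧ InjOn f V := by
      let e := h.toOpenPartialHomeomorph f
      exact ⟨e.source, e.open_source.mem_nhds h.mem_toOpenPartialHomeomorph_source,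
        e.open_source, e.injOn⟩
    exact ⟨V ∩ U, Filter.inter_mem hV (hU.mem_nhds hx), hVo.inter hU, inter_subset_right,
      hinj.mono inter_subset_left⟩
  choose! V hVn hVo hVU hVi using hloc
  obtain ⟨t, htU, htc, hcov⟩ := TopologicalSpace.countable_cover_nhdsWithin
    (fun x hx => mem_nhdsWithin_of_mem_nhds (hVn x hx))
  have hUeq : U = ⋃ x ∈ t, V x :=
    hcov.antisymm (iUnion₂_subset fun x hx => hVU x (htU hx))
  rcases t.eq_empty_or_nonempty with rfl | hne
  · refine ⟨fun _ => ∅, fun _ => .empty, fun _ _ _ => by simp [Function.onFun], ?_, by simp⟩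
    simp [hUeq]
  obtain ⟨g, rfl⟩ := htc.exists_eq_range hne
  refine ⟨disjointed (fun n => V (g n)), fun n => .disjointed
      (fun n => (hVo _ (htU ⟨n, rfl⟩)).measurableSet) n, disjoint_disjointed _, ?_,
      fun n => (hVi _ (htU ⟨n, rfl⟩)).mono (disjointed_subset _ n)⟩
  rw [iUnion_disjointed, hUeq]
  simp

/-- Area formula on an open set where the derivative is invertible. -/
theorem lintegral_count_fiber_eq_lintegral_abs_det_fderiv {E : Type*} [NormedAddCommGroup E]
    [NormedSpace ℝ E] [FiniteDimensional ℝ E] [MeasurableSpace E] [BorelSpace E]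
    (μ : Measure E) [μ.IsAddHaarMeasure]
    {f : E → E} {f' : E → E →L[ℝ] E} {U : Set E} (hU : IsOpen U)
    (hf : ∀ x ∈ U, HasStrictFDerivAt f (f' x) x) (hdet : ∀ x ∈ U, (f' x).det ≠ 0) :
    Measurable (fun y => Measure.count (U ∩ f ⁻¹' {y})) ∧
      ∫⁻ y, Measure.count (U ∩ f ⁻¹' {y}) ∂μ = ∫⁻ x in U, ENNReal.ofReal |(f' x).det| ∂μ := by
  obtain ⟨A, hAm, hAd, rfl, hAi⟩ := exists_measurable_partition_injOn hU hf hdet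
  have hd : ∀ n, ∀ x ∈ A n, HasFDerivWithinAt f (f' x) (A n) x := fun n x hx =>
    (hf x (mem_iUnion_of_mem n hx)).hasFDerivAt.hasFDerivWithinAt
  have himg : ∀ n, MeasurableSet (f '' A n) := fun n =>
    measurable_image_of_fderivWithin (hAm n) (hd n) (hAi n)
  have hfib : ∀ n y, Set.Subsingleton (A n ∩ f ⁻¹' {y}) := by
    rintro n y u ⟨hu, rfl⟩ v ⟨hv, hvu⟩
    exact hAi n hu hv hvu.symm
  have hcount : ∀ y, Measure.count ((⋃ n, A n) ∩ f ⁻¹' {y}) =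
      ∑' n, (f '' A n).indicator 1 y := by
    intro y
    rw [iUnion_inter, measure_iUnion
      (fun i j hij => (hAd hij).mono inter_subset_left inter_subset_left)
      (fun n => (hfib n y).measurableSet)]
    refine tsum_congr fun n => ?_
    by_cases hy : y ∈ f '' A n
    · obtain ⟨x, hx, rfl⟩ := hy
      have : A n ∩ f ⁻¹' {f x} = {x} := (hfib n (f x)).eq_singleton_of_mem ⟨hx, rfl⟩
      rw [this, indicator_of_mem (mem_image_of_mem f hx)]
      simp
    · have : A n ∩ f ⁻¹' {y} = ∅ := by
        rw [eq_empty_iff_forall_notMem]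
        rintro x ⟨hx, rfl⟩
        exact hy (mem_image_of_mem f hx)
      simp [this, hy]
  simp_rw [hcount]
  have hm : ∀ n, Measurable ((f '' A n).indicator (1 : E → ENNReal)) := fun n =>
    measurable_one.indicator (himg n)
  refine ⟨Measurable.tsum hm, ?_⟩
  rw [lintegral_tsum fun n => (hm n).aemeasurable, lintegral_iUnion hAm hAd]
  refine tsum_congr fun n => ?_
  rw [lintegral_indicator_one (himg n), lintegral_abs_det_fderiv_eq_addHaar_image μ (hAm n)
    (hd n) (hAi n)]

theorem integral_abs_cos_period : ∫ θ in (-π)..π, |cos θ| = 4 := by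
  have hi : ∀ u v : ℝ, IntervalIntegrable (fun θ => |cos θ|) volume u v := fun u v =>
    (continuous_cos.abs).intervalIntegrable u v
  have hper : Function.Periodic (fun θ => |cos θ|) (2 * π) := fun θ => by simp
  have h1 : ∫ θ in (-π)..π, |cos θ| = ∫ θ in (-(π / 2))..(-(π/2) + 2 * π), |cos θ| := by
    rw [← hper.intervalIntegral_add_eq (-π)]
    congr 1; ring
  rw [h1, ← intervalIntegral.integral_add_adjacent_intervals (hi _ (π / 2)) (hi _ _)]
  have h2 : ∫ θ in (-(π / 2))..(π / 2), |cos θ| = 2 := by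
    rw [intervalIntegral.integral_congr (g := cos), integral_cos]
    · simp; norm_num
    · intro θ hθ
      rw [uIcc_of_le (by linarith [pi_pos])] at hθ
      exact abs_of_nonneg (cos_nonneg_of_mem_Icc hθ)
  have h3 : ∫ θ in (π / 2)..(-(π/2) + 2 * π), |cos θ| = 2 := by
    have := intervalIntegral.integral_comp_add_right (a := -(π/2)) (b := π/2)
      (fun θ => |cos θ|) π
    simp only [cos_add_pi, abs_neg] at this
    rw [h2, show -(π / 2) + π = π / 2 by ring] at this
    rw [show -(π / 2) + 2 * π = π / 2 + π by ring]
    exact this.symm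
  rw [h2, h3]; norm_num

theorem integral_abs_mul_cos_add_mul_sin (A B : ℝ) :
    ∫ φ in (-π)..π, |A * cos φ + B * sin φ| = 4 * √(A ^ 2 + B ^ 2) := by
  set z : ℂ := ⟨A, B⟩ with hz
  have hnorm : ‖z‖ = √(A ^ 2 + B ^ 2) := by
    rw [Complex.norm_def, Complex.normSq_apply]; simp [hz, sq]
  have hA : A = ‖z‖ * cos z.arg := (Complex.norm_mul_cos_arg z).symm
  have hB : B = ‖z‖ * sin z.arg := (Complex.norm_mul_sin_arg z).symm
  have h : ∀ φ, |A * cos φ + B * sin φ| = ‖z‖ * |cos (φ - z.arg)| := by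
    intro φ
    nth_rw 1 [← abs_of_nonneg (norm_nonneg z)]
    rw [← abs_mul, cos_sub]
    congr 1
    conv_lhs => rw [hA, hB]
    ring
  have hper : Function.Periodic (fun θ => |cos θ|) (2 * π) := fun θ => by simp
  simp_rw [h]
  rw [intervalIntegral.integral_const_mul,
    intervalIntegral.integral_comp_sub_right (fun θ => |cos θ|), hnorm]
  have h1 := hper.intervalIntegral_add_eq (-π - z.arg) (-π)
  rw [show -π - z.arg + 2 * π = π - z.arg by ring, show -π + 2 * π = π by ring,
    integral_abs_cos_period] at h1
  rw [h1]; ring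

theorem integral_eq_four_mul_of_symm {f : ℝ → ℝ} (hf : Continuous f)
    (heven : ∀ t, f (-t) = f t) (hper : ∀ t, f (π - t) = f t) :
    ∫ t in (-π)..π, f t = 4 * ∫ t in (0:ℝ)..(π / 2), f t := by
  have hi : ∀ u v : ℝ, IntervalIntegrable f volume u v := fun u v => hf.intervalIntegrable u v
  have h1 : ∫ t in (-π)..0, f t = ∫ t in (0:ℝ)..π, f t := by
    have := intervalIntegral.integral_comp_neg (a := 0) (b := π) f
    simp only [heven, neg_zero] at this
    exact this.symm
  have h2 : ∫ t in (π / 2)..π, f t = ∫ t in (0:ℝ)..(π / 2), f t := by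
    have := intervalIntegral.integral_comp_sub_left (a := 0) (b := π / 2) f π
    simp only [hper, sub_zero, show π - π / 2 = π / 2 by ring] at this
    exact this.symm
  rw [← intervalIntegral.integral_add_adjacent_intervals (hi _ 0) (hi _ _), h1,
    ← intervalIntegral.integral_add_adjacent_intervals (hi 0 (π / 2)) (hi _ _), h2]
  ring

theorem integral_ellipse_speed {a b : ℝ} (hb : 0 < b) (hab : b ≤ a) :
    ∫ t in (-π)..π, √((a * sin t) ^ 2 + (b * cos t) ^ 2) = 4 * (a * Ecomp (ecc a b)) := by
  have ha : 0 < a := hb.trans_le hab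
  rw [integral_eq_four_mul_of_symm (by fun_prop) (by simp) (by simp)]
  congr 1
  have h := intervalIntegral.integral_comp_sub_left (a := 0) (b := π / 2)
    (fun t => √((a * sin t) ^ 2 + (b * cos t) ^ 2)) (π / 2)
  simp only [sub_self, sub_zero] at h
  rw [← h, Ecomp, Einc, ← intervalIntegral.integral_const_mul]
  congr 1
  ext t
  rw [sin_pi_div_two_sub, cos_pi_div_two_sub, ecc, div_pow,
    Real.sq_sqrt (by nlinarith), ← Real.sqrt_sq ha.le, ← Real.sqrt_mul (sq_nonneg _),
    Real.sqrt_sq ha.le]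
  congr 1
  field_simp
  rw [cos_sq']
  ring

theorem lintegral_ellipse_circle {a b r : ℝ} (hb : 0 < b) (hab : b ≤ a) (hr : 0 < r) :
    ∫⁻ p in Ioo (-π) π ×ˢ Ioo (-π) π,
      ENNReal.ofReal |r * (b * cos p.1 * sin p.2 - a * sin p.1 * cos p.2)| =
      ENNReal.ofReal (16 * r * a * Ecomp (ecc a b)) := by
  have hπ : -π ≤ π := by linarith [pi_pos]
  rw [Measure.volume_eq_prod, ← Measure.prod_restrict, lintegral_prod _ (by fun_prop)]
  have hin : ∀ t, ∫⁻ φ in Ioo (-π) π,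
      ENNReal.ofReal |r * (b * cos t * sin φ - a * sin t * cos φ)| =
      ENNReal.ofReal (r * (4 * √((a * sin t) ^ 2 + (b * cos t) ^ 2))) := by
    intro t
    have hc : Continuous fun φ => |r * (b * cos t * sin φ - a * sin t * cos φ)| := by fun_prop
    rw [← ofReal_integral_eq_lintegral_ofReal
      ((hc.integrableOn_Icc (a := -π) (b := π)).mono_set Ioo_subset_Icc_self)
      (.of_forall fun _ => abs_nonneg _), ← integral_Ioc_eq_integral_Ioo,
      ← intervalIntegral.integral_of_le hπ]
    simp_rw [abs_mul, abs_of_pos hr]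
    rw [intervalIntegral.integral_const_mul]
    congr 2
    have := integral_abs_mul_cos_add_mul_sin (-(a * sin t)) (b * cos t)
    rw [neg_sq] at this
    rw [← this]
    congr 1
    ext φ
    congr 1
    ring
  simp_rw [hin]
  have hc : Continuous fun t => r * (4 * √((a * sin t) ^ 2 + (b * cos t) ^ 2)) := by fun_prop
  rw [← ofReal_integral_eq_lintegral_ofReal
      ((hc.integrableOn_Icc (a := -π) (b := π)).mono_set Ioo_subset_Icc_self)
      (.of_forall fun _ => by positivity), ← integral_Ioc_eq_integral_Ioo,
      ← intervalIntegral.integral_of_le hπ, intervalIntegral.integral_const_mul,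
      intervalIntegral.integral_const_mul, integral_ellipse_speed hb hab]
  congr 1
  ring

open Polynomial in
theorem even_natDegree_of_forall_eval_ne_zero (p : ℝ[X]) (h : ∀ x, p.eval x ≠ 0) :
    Even p.natDegree := by
  induction p using UniqueFactorizationMonoid.induction_on_prime with
  | h₁ => simp at h
  | h₂ p hp => simp [natDegree_eq_zero_of_isUnit hp]
  | h₃ q p hq hp ih =>
    have hirr := hp.irreducible
    have h2 : p.natDegree ≤ 2 := hirr.natDegree_le_two
    have h0 : 0 < p.natDegree := hirr.natDegree_pos
    have h1 : p.natDegree ≠ 1 := fun h1 => by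
      obtain ⟨x, hx⟩ := exists_root_of_degree_eq_one ((degree_eq_iff_natDegree_eq hp.ne_zero).2 h1)
      exact h x (by rw [eval_mul, IsRoot.def.1 hx, zero_mul])
    rw [natDegree_mul hp.ne_zero hq, show p.natDegree = 2 by omega]
    exact even_two.add (ih fun x hx => h x (by rw [eval_mul, hx, mul_zero]))

open Polynomial in
theorem encard_roots_of_natDegree_eq_four {p : ℝ[X]} (hp : p.natDegree = 4)
    (h : ∀ x, p.eval x = 0 → p.derivative.eval x ≠ 0) :
    {x | p.eval x = 0}.encard = 0 ∨ {x | p.eval x = 0}.encard = 2 ∨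
      {x | p.eval x = 0}.encard = 4 := by
  have hp0 : p ≠ 0 := by rintro rfl; simp at hp
  have hnd : p.roots.Nodup := by
    rw [Multiset.nodup_iff_count_le_one]
    intro x
    rw [count_roots]
    by_contra! hx
    obtain ⟨h1, h2⟩ := (one_lt_rootMultiplicity_iff_isRoot hp0).1 hx
    exact h x h1 h2
  have hset : {x | p.eval x = 0} = (p.roots.toFinset : Set ℝ) := by
    ext x; simp [hp0]
  obtain ⟨q, hq, hcard, hqr⟩ := exists_prod_multiset_X_sub_C_mul p
  have hq0 : q ≠ 0 := by rintro rfl; simp at hq; exact hp0 hq.symm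
  have hev : Even q.natDegree := even_natDegree_of_forall_eval_ne_zero q fun x hx => by
    have : x ∈ q.roots := by rw [mem_roots hq0]; exact hx
    simp [hqr] at this
  rw [hset, encard_coe_eq_coe_finsetCard, Multiset.toFinset_card_of_nodup hnd]
  obtain ⟨k, hk⟩ := hev
  have : p.roots.card = 0 ∨ p.roots.card = 2 ∨ p.roots.card = 4 := by omega
  rcases this with h | h | h <;> simp [h]

/-- The points of the ellipse with semi-axes `a`, `b` on the circle of radius `r` about `y`. -/
def ellipseInterCircle (a b r : ℝ) (y : ℝ × ℝ) : Set (ℝ × ℝ) :=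
  {q | q.1 ^ 2 / a ^ 2 + q.2 ^ 2 / b ^ 2 = 1 ∧ (q.1 - y.1) ^ 2 + (q.2 - y.2) ^ 2 = r ^ 2}

open Polynomial in
/-- The quartic whose roots parametrize rationally the points of `ellipseInterCircle a b r y`
other than `(-a, 0)`. -/
def interQuartic (a b r : ℝ) (y : ℝ × ℝ) : ℝ[X] :=
  (C a * (1 - X ^ 2) - C y.1 * (1 + X ^ 2)) ^ 2 + (C (2 * b) * X - C y.2 * (1 + X ^ 2)) ^ 2
    - C (r ^ 2) * (1 + X ^ 2) ^ 2

/-- Rational parametrization of the ellipse with semi-axes `a`, `b`. -/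
def ellipseRat (a b s : ℝ) : ℝ × ℝ :=
  (a * (1 - s ^ 2) / (1 + s ^ 2), 2 * b * s / (1 + s ^ 2))

theorem eval_interQuartic (a b r s : ℝ) (y : ℝ × ℝ) :
    (interQuartic a b r y).eval s = (1 + s ^ 2) ^ 2 *
      (((ellipseRat a b s).1 - y.1) ^ 2 + ((ellipseRat a b s).2 - y.2) ^ 2 - r ^ 2) := by
  have : 1 + s ^ 2 ≠ 0 := by positivity
  simp [interQuartic, ellipseRat]
  field_simp

theorem eval_derivative_interQuartic {a b r s : ℝ} (ha : a ≠ 0) (hb : b ≠ 0) (y : ℝ × ℝ) :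
    (interQuartic a b r y).derivative.eval s =
      4 * s * (1 + s ^ 2) *
        (((ellipseRat a b s).1 - y.1) ^ 2 + ((ellipseRat a b s).2 - y.2) ^ 2 - r ^ 2)
      - 4 * (1 + s ^ 2) * (b / a * (ellipseRat a b s).1 * (y.2 - (ellipseRat a b s).2)
        - a / b * (ellipseRat a b s).2 * (y.1 - (ellipseRat a b s).1)) := by
  have : 1 + s ^ 2 ≠ 0 := by positivity
  simp [interQuartic, ellipseRat, Polynomial.derivative_pow]
  field_simp
  ring

theorem natDegree_interQuartic {a b r : ℝ} {y : ℝ × ℝ}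
    (h : (-a - y.1) ^ 2 + (0 - y.2) ^ 2 ≠ r ^ 2) : (interQuartic a b r y).natDegree = 4 := by
  unfold interQuartic
  compute_degree!
  contrapose! h
  linear_combination h

theorem ellipseInterCircle_eq_image {a b r : ℝ} (ha : 0 < a) (hb : 0 < b) {y : ℝ × ℝ}
    (h : (-a, 0) ∉ ellipseInterCircle a b r y) :
    ellipseInterCircle a b r y = ellipseRat a b '' {s | (interQuartic a b r y).eval s = 0} := by
  ext q
  constructor
  · rintro ⟨h1, h2⟩
    have hq : q.1 + a ≠ 0 := by
      intro hq
      have hq1 : q.1 = -a := by linarith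
      rw [hq1, neg_sq, div_self (by positivity)] at h1
      have hq2 : q.2 = 0 := by
        have : q.2 ^ 2 / b ^ 2 = 0 := by linarith
        simpa [hb.ne'] using this
      apply h
      have : q = (-a, 0) := Prod.ext hq1 hq2
      rw [← this]
      refine ⟨?_, h2⟩
      rw [hq1, hq2]; field_simp; simp
    set s := a * q.2 / (b * (q.1 + a)) with hs
    have hrat : ellipseRat a b s = q := by
      have hs1 : 1 + s ^ 2 = 2 * a / (q.1 + a) := by
        rw [hs]
        field_simp at h1 ⊢
        linear_combination h1
      have h3 : 1 - s ^ 2 = 2 * q.1 / (q.1 + a) := by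
        have : 1 - s ^ 2 = 2 - (1 + s ^ 2) := by ring
        rw [this, hs1]; field_simp; ring
      unfold ellipseRat
      rw [hs1, h3, hs]
      ext <;> simp <;> field_simp
    refine ⟨s, ?_, hrat⟩
    rw [mem_ofPred_eq, eval_interQuartic, hrat, h2, sub_self, mul_zero]
  · rintro ⟨s, hs, rfl⟩
    have h1 : 1 + s ^ 2 ≠ 0 := by positivity
    rw [mem_ofPred_eq, eval_interQuartic, mul_eq_zero] at hs
    refine ⟨?_, sub_eq_zero.1 (hs.resolve_left (by positivity))⟩
    simp only [ellipseRat]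
    field_simp
    ring

theorem injective_ellipseRat {a b : ℝ} (ha : 0 < a) (hb : 0 < b) :
    Function.Injective (ellipseRat a b) := by
  intro s t h
  have hs : 1 + s ^ 2 ≠ 0 := by positivity
  have ht : 1 + t ^ 2 ≠ 0 := by positivity
  simp only [ellipseRat, Prod.mk.injEq] at h
  obtain ⟨h1, h2⟩ := h
  field_simp at h1 h2
  have h3 : 1 + t ^ 2 = 1 + s ^ 2 := by linear_combination h1 / 2
  rw [h3] at h2
  exact mul_right_cancel₀ hs (h2.trans (mul_comm _ _))

/-- A circle meeting the ellipse only transversally, away from one of its vertices, meets it in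
an even number of points, at most four. -/
theorem encard_ellipseInterCircle {a b r : ℝ} (ha : 0 < a) (hb : 0 < b) {y : ℝ × ℝ}
    (h : ∀ q ∈ ellipseInterCircle a b r y, q ≠ (-a, 0) ∧
      b / a * q.1 * (y.2 - q.2) - a / b * q.2 * (y.1 - q.1) ≠ 0) :
    (ellipseInterCircle a b r y).encard = 0 ∨ (ellipseInterCircle a b r y).encard = 2 ∨
      (ellipseInterCircle a b r y).encard = 4 := by
  have hv : (-a, 0) ∉ ellipseInterCircle a b r y := fun hv => (h _ hv).1 rfl
  have himg := ellipseInterCircle_eq_image ha hb hv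
  have hdeg : (interQuartic a b r y).natDegree = 4 := by
    refine natDegree_interQuartic fun h => hv ⟨?_, h⟩
    simp [ha.ne']
  have := encard_roots_of_natDegree_eq_four hdeg fun s hs => by
    have hmem : ellipseRat a b s ∈ ellipseInterCircle a b r y := by
      rw [himg]; exact mem_image_of_mem _ hs
    rw [eval_derivative_interQuartic ha.ne' hb.ne', hmem.2, sub_self, mul_zero, zero_sub,
      neg_ne_zero]
    exact mul_ne_zero (by positivity) (h _ hmem).2
  rwa [himg, (injective_ellipseRat ha hb).encard_image]

/-- The point at angle `φ` on the circle of radius `r` centred at the point of the ellipse with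
eccentric anomaly `t`, as a function of `(t, φ)`. -/
def ellipseAddCircle (a b r : ℝ) (p : ℝ × ℝ) : ℝ × ℝ :=
  (a * cos p.1 + r * cos p.2, b * sin p.1 + r * sin p.2)

/-- The derivative of `ellipseAddCircle`. -/
def fderivEllipseAddCircle (a b r : ℝ) (p : ℝ × ℝ) : ℝ × ℝ →L[ℝ] ℝ × ℝ :=
  (Matrix.toLin (.finTwoProd ℝ) (.finTwoProd ℝ)
    !![-a * sin p.1, -r * sin p.2; b * cos p.1, r * cos p.2]).toContinuousLinearMap

theorem hasStrictFDerivAt_ellipseAddCircle (a b r : ℝ) (p : ℝ × ℝ) :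
    HasStrictFDerivAt (ellipseAddCircle a b r) (fderivEllipseAddCircle a b r p) p := by
  unfold fderivEllipseAddCircle
  rw [Matrix.toLin_finTwoProd_toContinuousLinearMap]
  have h1 := hasStrictFDerivAt_fst (𝕜 := ℝ) (p := p)
  have h2 := hasStrictFDerivAt_snd (𝕜 := ℝ) (p := p)
  convert! HasStrictFDerivAt.prodMk (𝕜 := ℝ)
    ((((hasStrictDerivAt_cos p.1).comp_hasStrictFDerivAt p h1).const_mul a).add
      (((hasStrictDerivAt_cos p.2).comp_hasStrictFDerivAt p h2).const_mul r))
    ((((hasStrictDerivAt_sin p.1).comp_hasStrictFDerivAt p h1).const_mul b).add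
      (((hasStrictDerivAt_sin p.2).comp_hasStrictFDerivAt p h2).const_mul r)) using 2 <;>
  simp [smul_smul, neg_smul _ (ContinuousLinearMap.fst ℝ ℝ ℝ),
    neg_smul _ (ContinuousLinearMap.snd ℝ ℝ ℝ)]

theorem det_fderivEllipseAddCircle (a b r : ℝ) (p : ℝ × ℝ) :
    (fderivEllipseAddCircle a b r p).det =
      r * (b * cos p.1 * sin p.2 - a * sin p.1 * cos p.2) := by
  unfold fderivEllipseAddCircle
  simp only [LinearMap.det_toContinuousLinearMap, LinearMap.det_toLin, Matrix.det_fin_two_of]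
  ring

/-- The parameters of `ellipseAddCircle` at which it is singular or meets the boundary of the
fundamental domain. -/
def exceptionalParams (a b r : ℝ) : Set (ℝ × ℝ) :=
  {p | (fderivEllipseAddCircle a b r p).det = 0} ∪ ({p | p.1 = π} ∪ {p | p.2 = π})

/-- The regular parameters of `ellipseAddCircle` in an open fundamental domain. -/
def regularParams (a b r : ℝ) : Set (ℝ × ℝ) :=
  (Ioo (-π) π ×ˢ Ioo (-π) π) ∩ {p | (fderivEllipseAddCircle a b r p).det ≠ 0}

theorem isOpen_regularParams (a b r : ℝ) : IsOpen (regularParams a b r) := by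
  refine (isOpen_Ioo.prod isOpen_Ioo).inter ?_
  simp_rw [det_fderivEllipseAddCircle]
  exact isOpen_ne_fun (by fun_prop) (by fun_prop)

theorem volume_image_exceptionalParams (a b r : ℝ) :
    volume (ellipseAddCircle a b r '' exceptionalParams a b r) = 0 := by
  have hd := fun p => (hasStrictFDerivAt_ellipseAddCircle a b r p).hasFDerivAt
  have hdiff : Differentiable ℝ (ellipseAddCircle a b r) := fun p => (hd p).differentiableAt
  have := Measure.prod.instIsAddHaarMeasure (volume : Measure ℝ) (volume : Measure ℝ)
  rw [exceptionalParams, image_union, measure_union_null_iff]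
  constructor
  · exact addHaar_image_eq_zero_of_det_fderivWithin_eq_zero (μ := volume)
      (fun p _ => (hd p).hasFDerivWithinAt) fun p hp => hp
  · refine addHaar_image_eq_zero_of_differentiableOn_of_addHaar_eq_zero volume
      hdiff.differentiableOn ?_
    have h1 : {p : ℝ × ℝ | p.1 = π} = {π} ×ˢ univ := by ext; simp
    have h2 : {p : ℝ × ℝ | p.2 = π} = univ ×ˢ {π} := by ext; simp
    rw [measure_union_null_iff, h1, h2, Measure.volume_eq_prod, Measure.prod_prod,
      Measure.prod_prod]
    simp

theorem exists_mem_Ioc_cos_sin {c s : ℝ} (h : c ^ 2 + s ^ 2 = 1) :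
    ∃ t ∈ Ioc (-π) π, cos t = c ∧ sin t = s := by
  have hn : ‖(⟨c, s⟩ : ℂ)‖ = 1 := by
    rw [Complex.norm_def, Complex.normSq_apply, ← sq, ← sq, h, Real.sqrt_one]
  refine ⟨Complex.arg ⟨c, s⟩, Complex.arg_mem_Ioc _, ?_, ?_⟩
  · simpa [hn] using Complex.norm_mul_cos_arg (⟨c, s⟩ : ℂ)
  · simpa [hn] using Complex.norm_mul_sin_arg (⟨c, s⟩ : ℂ)

theorem eq_of_mem_Ioo_of_cos_eq_of_sin_eq {s t : ℝ} (hs : s ∈ Ioo (-π) π) (ht : t ∈ Ioo (-π) π)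
    (hc : cos s = cos t) (hsin : sin s = sin t) : s = t := by
  have h := Real.Angle.cos_sin_inj hc hsin
  rw [← Real.Angle.toReal_coe_eq_self_iff.2 ⟨hs.1, hs.2.le⟩, h,
    Real.Angle.toReal_coe_eq_self_iff.2 ⟨ht.1, ht.2.le⟩]

theorem exists_params_of_mem_ellipseInterCircle {a b r : ℝ} (ha : 0 < a) (hb : 0 < b)
    (hr : 0 < r) {y q : ℝ × ℝ} (hq : q ∈ ellipseInterCircle a b r y) :
    ∃ p ∈ Ioc (-π) π ×ˢ Ioc (-π) π, ellipseAddCircle a b r p = y ∧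
      q = (a * cos p.1, b * sin p.1) := by
  obtain ⟨h1, h2⟩ := hq
  obtain ⟨t, ht, hct, hst⟩ := exists_mem_Ioc_cos_sin (c := q.1 / a) (s := q.2 / b)
    (by rw [div_pow, div_pow, h1])
  obtain ⟨φ, hφ, hcφ, hsφ⟩ := exists_mem_Ioc_cos_sin (c := (y.1 - q.1) / r) (s := (y.2 - q.2) / r)
    (by field_simp; linear_combination h2)
  refine ⟨(t, φ), ⟨ht, hφ⟩, ?_, ?_⟩
  · ext <;> simp only [ellipseAddCircle, hct, hst, hcφ, hsφ] <;> field_simp <;> ring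
  · ext <;> simp only [hct, hst] <;> field_simp

theorem mem_regularParams_of_notMem_image {a b r : ℝ} {p : ℝ × ℝ}
    (hp : p ∈ Ioc (-π) π ×ˢ Ioc (-π) π)
    (hy : ellipseAddCircle a b r p ∉ ellipseAddCircle a b r '' exceptionalParams a b r) :
    p ∈ regularParams a b r := by
  have hE : p ∉ exceptionalParams a b r := fun h => hy (mem_image_of_mem _ h)
  simp only [exceptionalParams, mem_union, mem_ofPred_eq, not_or] at hE
  exact ⟨⟨⟨hp.1.1, hp.1.2.lt_of_ne hE.2.1⟩, ⟨hp.2.1, hp.2.2.lt_of_ne hE.2.2⟩⟩, hE.1⟩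

theorem encard_regularParams_inter_fiber {a b r : ℝ} (ha : 0 < a) (hb : 0 < b) (hr : 0 < r)
    {y : ℝ × ℝ} (hy : y ∉ ellipseAddCircle a b r '' exceptionalParams a b r) :
    (regularParams a b r ∩ ellipseAddCircle a b r ⁻¹' {y}).encard =
      (ellipseInterCircle a b r y).encard := by
  have himg : ellipseInterCircle a b r y = (fun p : ℝ × ℝ => (a * cos p.1, b * sin p.1)) ''
      (regularParams a b r ∩ ellipseAddCircle a b r ⁻¹' {y}) := by
    ext q
    constructor
    · intro hq
      obtain ⟨p, hp, rfl, rfl⟩ := exists_params_of_mem_ellipseInterCircle ha hb hr hq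
      exact ⟨p, ⟨mem_regularParams_of_notMem_image hp hy, rfl⟩, rfl⟩
    · rintro ⟨p, ⟨-, rfl⟩, rfl⟩
      refine ⟨?_, ?_⟩
      · simp only [mul_pow]
        field_simp
        exact cos_sq_add_sin_sq _
      · simp only [ellipseAddCircle]
        linear_combination r ^ 2 * sin_sq_add_cos_sq p.2
  rw [himg, InjOn.encard_image]
  rintro p ⟨⟨⟨hp1, hp2⟩, -⟩, hpy⟩ p' ⟨⟨⟨hp1', hp2'⟩, -⟩, hpy'⟩ h
  simp only [Prod.mk.injEq, mul_right_inj' ha.ne', mul_right_inj' hb.ne'] at h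
  have hF : ellipseAddCircle a b r p = ellipseAddCircle a b r p' := Eq.trans hpy hpy'.symm
  simp only [ellipseAddCircle, Prod.mk.injEq, h.1, h.2, add_right_inj, mul_right_inj' hr.ne']
    at hF
  exact Prod.ext (eq_of_mem_Ioo_of_cos_eq_of_sin_eq hp1 hp1' h.1 h.2)
    (eq_of_mem_Ioo_of_cos_eq_of_sin_eq hp2 hp2' hF.1 hF.2)

theorem encard_ellipseInterCircle_of_notMem_image {a b r : ℝ} (ha : 0 < a) (hb : 0 < b)
    (hr : 0 < r) {y : ℝ × ℝ} (hy : y ∉ ellipseAddCircle a b r '' exceptionalParams a b r) :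
    (ellipseInterCircle a b r y).encard = 0 ∨ (ellipseInterCircle a b r y).encard = 2 ∨
      (ellipseInterCircle a b r y).encard = 4 := by
  refine encard_ellipseInterCircle ha hb fun q hq => ?_
  obtain ⟨p, hp, rfl, rfl⟩ := exists_params_of_mem_ellipseInterCircle ha hb hr hq
  have hreg := mem_regularParams_of_notMem_image hp hy
  constructor
  · intro h
    simp only [Prod.mk.injEq] at h
    have hc : cos p.1 = cos π := by
      rw [cos_pi]
      exact mul_left_cancel₀ ha.ne' (by linarith [h.1])
    have hs : sin p.1 = sin π := by
      rw [sin_pi]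
      exact (mul_eq_zero.1 h.2).resolve_left hb.ne'
    have h2 := Real.Angle.cos_sin_inj hc hs
    rw [← Real.Angle.toReal_inj, Real.Angle.toReal_coe_eq_self_iff.2 hp.1,
      Real.Angle.toReal_coe_eq_self_iff.2 ⟨by linarith [pi_pos], le_rfl⟩] at h2
    exact hreg.1.1.2.ne h2
  · have hdet : (fderivEllipseAddCircle a b r p).det ≠ 0 := hreg.2
    rw [det_fderivEllipseAddCircle] at hdet
    convert! hdet using 1
    simp only [ellipseAddCircle]
    field_simp
    ring

theorem lintegral_abs_det_regularParams {a b r : ℝ} (hb : 0 < b) (hab : b ≤ a) (hr : 0 < r) :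
    ∫⁻ p in regularParams a b r, ENNReal.ofReal |(fderivEllipseAddCircle a b r p).det| =
      ENNReal.ofReal (16 * r * a * Ecomp (ecc a b)) := by
  rw [← lintegral_ellipse_circle hb hab hr]
  simp_rw [← det_fderivEllipseAddCircle]
  rw [← lintegral_indicator (isOpen_regularParams a b r).measurableSet,
    ← lintegral_indicator (measurableSet_Ioo.prod measurableSet_Ioo)]
  congr 1
  ext p
  by_cases h : (fderivEllipseAddCircle a b r p).det = 0 <;>
    simp [regularParams, indicator, h]

theorem poincare_identity_prod {a b r : ℝ} (hb : 0 < b) (hab : b ≤ a) (hr : 0 < r) :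
    2 * volume {y | (ellipseInterCircle a b r y).ncard = 2}
      + 4 * volume {y | (ellipseInterCircle a b r y).ncard = 4}
      = ENNReal.ofReal (16 * r * a * Ecomp (ecc a b)) := by
  have ha : 0 < a := hb.trans_le hab
  have := Measure.prod.instIsAddHaarMeasure (volume : Measure ℝ) (volume : Measure ℝ)
  have hopen := isOpen_regularParams a b r
  obtain ⟨hm, harea⟩ := lintegral_count_fiber_eq_lintegral_abs_det_fderiv (volume : Measure (ℝ × ℝ))
    hopen (fun p _ => hasStrictFDerivAt_ellipseAddCircle a b r p) fun p hp => hp.2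
  rw [lintegral_abs_det_regularParams hb hab hr] at harea
  have hcont : Continuous (ellipseAddCircle a b r) := by unfold ellipseAddCircle; fun_prop
  obtain ⟨M, hM⟩ : ∃ M : ℝ × ℝ → ENNReal, M = fun y =>
    Measure.count (regularParams a b r ∩ ellipseAddCircle a b r ⁻¹' {y}) := ⟨_, rfl⟩
  rw [← hM] at hm harea
  have hae : ∀ᵐ y : ℝ × ℝ, M y = (ellipseInterCircle a b r y).encard ∧
      ((ellipseInterCircle a b r y).encard = 0 ∨ (ellipseInterCircle a b r y).encard = 2 ∨
        (ellipseInterCircle a b r y).encard = 4) := by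
    filter_upwards [measure_eq_zero_iff_ae_notMem.1 (volume_image_exceptionalParams a b r)]
      with y hy
    refine ⟨?_, encard_ellipseInterCircle_of_notMem_image ha hb hr hy⟩
    rw [hM, ← encard_regularParams_inter_fiber ha hb hr hy]
    refine Measure.count_apply ?_
    exact hopen.measurableSet.inter ((measurableSet_singleton y).preimage hcont.measurable)
  have h2 : volume {y | (ellipseInterCircle a b r y).ncard = 2} = volume {y | M y = 2} := by
    refine measure_congr ?_
    filter_upwards [hae] with y hy
    refine propext ?_
    change (ellipseInterCircle a b r y).ncard = 2 ↔ M y = 2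
    rcases hy with ⟨h, h' | h' | h'⟩ <;> rw [h, ncard, h'] <;> norm_num
  have h4 : volume {y | (ellipseInterCircle a b r y).ncard = 4} = volume {y | M y = 4} := by
    refine measure_congr ?_
    filter_upwards [hae] with y hy
    refine propext ?_
    change (ellipseInterCircle a b r y).ncard = 4 ↔ M y = 4
    rcases hy with ⟨h, h' | h' | h'⟩ <;> rw [h, ncard, h'] <;> norm_num
  have hs2 : MeasurableSet {y | M y = 2} := hm (measurableSet_singleton 2)
  have hs4 : MeasurableSet {y | M y = 4} := hm (measurableSet_singleton 4)
  rw [h2, h4, ← harea, ← lintegral_indicator_const hs2, ← lintegral_indicator_const hs4,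
    ← lintegral_add_left (measurable_const.indicator hs2)]
  refine lintegral_congr_ae ?_
  filter_upwards [hae] with y hy
  rcases hy with ⟨h, h' | h' | h'⟩ <;> rw [h'] at h <;> simp [indicator, h]

/-- Cartesian coordinates on the Euclidean plane, as a measurable equivalence. -/
def planeCoord : E2 ≃ᵐ ℝ × ℝ :=
  (MeasurableEquiv.toLp 2 (Fin 2 → ℝ)).symm.trans MeasurableEquiv.finTwoArrow

theorem measurePreserving_planeCoord : MeasurePreserving planeCoord :=
  (volume_preserving_finTwoArrow ℝ).comp (PiLp.volume_preserving_ofLp (Fin 2))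

theorem ncard_sphere_inter_Cset_s11 {a b r : ℝ} (hr : 0 < r) (x : E2) :
    (sphere x r ∩ Cset a b).ncard = (ellipseInterCircle a b r (planeCoord x)).ncard := by
  rw [← ncard_image_of_injective _ planeCoord.injective, planeCoord.image_eq_preimage_symm]
  congr 1
  ext q
  obtain ⟨z, rfl⟩ := planeCoord.surjective q
  have hsphere : z ∈ sphere x r ↔ (z 0 - x 0) ^ 2 + (z 1 - x 1) ^ 2 = r ^ 2 := by
    rw [mem_sphere, EuclideanSpace.dist_eq, Real.sqrt_eq_iff_mul_self_eq_of_pos hr, ← sq,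
      eq_comm]
    simp [Real.dist_eq, sq_abs]
  rw [mem_preimage, planeCoord.symm_apply_apply, mem_inter_iff, hsphere, and_comm]
  rfl

/-- Poincaré's formula for the ellipse and circle: in all cases,
`2·A₂ + 4·A₄ = 16raE(ε)`. -/
theorem poincare_identity (a b r : ℝ) (hb : 0 < b) (hab : b ≤ a) (hr : 0 < r) :
    2 * volume {x : E2 | (sphere x r ∩ Cset a b).ncard = 2}
      + 4 * volume {x : E2 | (sphere x r ∩ Cset a b).ncard = 4}
      = ENNReal.ofReal (16 * r * a * Ecomp (ecc a b)) := by
  have h : ∀ n, volume {x : E2 | (sphere x r ∩ Cset a b).ncard = n} =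
      volume {y | (ellipseInterCircle a b r y).ncard = n} := by
    intro n
    rw [← measurePreserving_planeCoord.measure_preimage_equiv]
    simp_rw [ncard_sphere_inter_Cset_s11 hr]
    rfl
  rw [h, h]
  exact poincare_identity_prod hb hab hr
end
end

section
/- Let a > b > 0, r > 0, and p(φ) = √(a² cos²φ + b² sin²φ). There exists φ ∈ ℝ with p(φ) + p''(φ) = r if and only if b²/a ≤ r ≤ a²/b; moreover, when b²/a ≤ r ≤ a²/b, the value λ = (1/2)·arccos( (2(a²b²/r)^{2/3} − a² − b²) / (a² − b²) ) satisfies p(λ) + p''(λ) = r, and the solutions in [0, 2π] are exactly λ, π − λ, π + λ, and 2π − λ. -/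
open Real Set

noncomputable section

/-- Support function of the ellipse with semi-axes `a`, `b`. -/
def psup (a b φ : ℝ) : ℝ := Real.sqrt (a^2 * Real.cos φ^2 + b^2 * Real.sin φ^2)

/-- The angle `λ` locating a cusp of the inner parallel curve at distance `r`. -/
def lamAng (a b r : ℝ) : ℝ :=
  (1/2) * Real.arccos ((2*(a^2*b^2/r) ^ ((2:ℝ)/3) - a^2 - b^2) / (a^2 - b^2))

theorem psup_arg_pos {a b : ℝ} (ha : 0 < a) (hb : 0 < b) (φ : ℝ) :
    0 < a ^ 2 * cos φ ^ 2 + b ^ 2 * sin φ ^ 2 := by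
  rcases eq_or_ne (sin φ) 0 with h | h
  · have hc : cos φ ^ 2 = 1 := by nlinarith [sin_sq_add_cos_sq φ]
    rw [hc]
    positivity
  · positivity

theorem psup_pos {a b : ℝ} (ha : 0 < a) (hb : 0 < b) (φ : ℝ) : 0 < psup a b φ :=
  sqrt_pos.2 (psup_arg_pos ha hb φ)

theorem psup_sq {a b : ℝ} (ha : 0 < a) (hb : 0 < b) (φ : ℝ) :
    psup a b φ ^ 2 = a ^ 2 * cos φ ^ 2 + b ^ 2 * sin φ ^ 2 :=
  sq_sqrt (psup_arg_pos ha hb φ).le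

theorem hasDerivAt_psup {a b : ℝ} (ha : 0 < a) (hb : 0 < b) (φ : ℝ) :
    HasDerivAt (psup a b) ((b ^ 2 - a ^ 2) * (sin φ * cos φ) / psup a b φ) φ := by
  have h := ((((hasDerivAt_cos φ).pow 2).const_mul (a ^ 2)).add
    (((hasDerivAt_sin φ).pow 2).const_mul (b ^ 2))).sqrt (psup_arg_pos ha hb φ).ne'
  refine h.congr_deriv ?_
  change _ / (2 * psup a b φ) = _
  have hp := (psup_pos ha hb φ).ne'
  field_simp
  simp
  ring

theorem deriv_psup {a b : ℝ} (ha : 0 < a) (hb : 0 < b) :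
    deriv (psup a b) = fun φ => (b ^ 2 - a ^ 2) * (sin φ * cos φ) / psup a b φ :=
  funext fun φ => (hasDerivAt_psup ha hb φ).deriv

/-- The radius of curvature of the ellipse in terms of its support function. -/
theorem psup_add_deriv_deriv {a b : ℝ} (ha : 0 < a) (hb : 0 < b) (φ : ℝ) :
    psup a b φ + deriv (deriv (psup a b)) φ = a ^ 2 * b ^ 2 / psup a b φ ^ 3 := by
  have hp := (psup_pos ha hb φ).ne'
  have h := (((hasDerivAt_sin φ).mul (hasDerivAt_cos φ)).const_mul (b ^ 2 - a ^ 2)).div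
    (hasDerivAt_psup ha hb φ) hp
  rw [deriv_psup ha hb]
  erw [h.deriv]
  have hq := psup_sq ha hb φ
  have hs := sin_sq φ
  simp only [Pi.mul_apply]
  field_simp
  rw [show psup a b φ ^ 4 = (psup a b φ ^ 2) ^ 2 by ring, hq, hs]
  ring

theorem exists_pow_three_eq_and_sq_eq {x : ℝ} (hx : 0 < x) :
    ∃ y : ℝ, 0 < y ∧ y ^ 3 = x ∧ y ^ 2 = x ^ ((2 : ℝ) / 3) := by
  refine ⟨x ^ ((1 : ℝ) / 3), by positivity, ?_, ?_⟩
  · rw [← rpow_natCast, ← rpow_mul hx.le]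
    norm_num
  · rw [← rpow_natCast, ← rpow_mul hx.le]
    norm_num

theorem psup_add_deriv_deriv_eq_iff {a b r : ℝ} (hb : 0 < b) (hba : b < a) (hr : 0 < r) (φ : ℝ) :
    psup a b φ + deriv (deriv (psup a b)) φ = r ↔
      cos (2 * φ) = (2 * (a ^ 2 * b ^ 2 / r) ^ ((2 : ℝ) / 3) - a ^ 2 - b ^ 2) / (a ^ 2 - b ^ 2) := by
  have ha := hb.trans hba
  obtain ⟨y, hy, hy3, hy2⟩ :=
    exists_pow_three_eq_and_sq_eq (x := a ^ 2 * b ^ 2 / r) (by positivity)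
  have hp := psup_pos ha hb φ
  have hab : 0 < a ^ 2 - b ^ 2 := by nlinarith
  have h1 : a ^ 2 * b ^ 2 / psup a b φ ^ 3 = r ↔ psup a b φ ^ 3 = y ^ 3 := by
    rw [hy3, div_eq_iff (by positivity), eq_div_iff hr.ne', eq_comm, mul_comm]
  rw [psup_add_deriv_deriv ha hb, h1, pow_left_inj₀ hp.le hy.le (by norm_num),
    ← pow_left_inj₀ hp.le hy.le two_ne_zero, ← hy2, eq_div_iff hab.ne', psup_sq ha hb,
    cos_two_mul, sin_sq]
  constructor <;> intro h <;> linarith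

theorem cos_two_mul_cusp_mem_Icc_iff {a b r : ℝ} (hb : 0 < b) (hba : b < a) (hr : 0 < r) :
    (2 * (a ^ 2 * b ^ 2 / r) ^ ((2 : ℝ) / 3) - a ^ 2 - b ^ 2) / (a ^ 2 - b ^ 2) ∈ Icc (-1 : ℝ) 1 ↔
      b ^ 2 / a ≤ r ∧ r ≤ a ^ 2 / b := by
  have ha := hb.trans hba
  obtain ⟨y, hy, hy3, hy2⟩ :=
    exists_pow_three_eq_and_sq_eq (x := a ^ 2 * b ^ 2 / r) (by positivity)
  have hab : 0 < a ^ 2 - b ^ 2 := by nlinarith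
  have h1 : b ^ 2 / a ≤ r ↔ y ^ 2 ≤ a ^ 2 := by
    rw [pow_le_pow_iff_left₀ hy.le ha.le two_ne_zero,
      ← pow_le_pow_iff_left₀ hy.le ha.le three_ne_zero, hy3, div_le_iff₀ hr, div_le_iff₀ ha,
      show a ^ 3 * r = a ^ 2 * (r * a) by ring]
    exact (mul_le_mul_iff_right₀ (by positivity)).symm
  have h2 : r ≤ a ^ 2 / b ↔ b ^ 2 ≤ y ^ 2 := by
    rw [pow_le_pow_iff_left₀ hb.le hy.le two_ne_zero,
      ← pow_le_pow_iff_left₀ hb.le hy.le three_ne_zero, hy3, le_div_iff₀ hr, le_div_iff₀ hb,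
      show b ^ 3 * r = b ^ 2 * (r * b) by ring, mul_comm (a ^ 2)]
    exact (mul_le_mul_iff_right₀ (by positivity)).symm
  rw [h1, h2, ← hy2, mem_Icc, le_div_iff₀ hab, div_le_iff₀ hab]
  constructor <;> rintro ⟨h, h'⟩ <;> constructor <;> linarith

theorem setOf_cos_two_mul_eq {l : ℝ} (h0 : 0 ≤ l) (hl : l ≤ π / 2) :
    {φ ∈ Icc (0 : ℝ) (2 * π) | cos (2 * φ) = cos (2 * l)} = {l, π - l, π + l, 2 * π - l} := by
  have hπ := pi_pos
  ext φ
  simp only [mem_ofPred_eq, mem_Icc, mem_insert_iff, mem_singleton_iff]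
  constructor
  · rintro ⟨⟨hφ0, hφ⟩, h⟩
    obtain ⟨k, hk⟩ := cos_eq_cos_iff.1 h.symm
    have hk1 : (-1 : ℝ) < k := by
      by_contra! hc
      rcases hk with hk | hk <;> nlinarith
    have hk2 : (k : ℝ) < 3 := by
      by_contra! hc
      rcases hk with hk | hk <;> nlinarith
    have hk1' : -1 < k := by exact_mod_cast hk1
    have hk2' : k < 3 := by exact_mod_cast hk2
    interval_cases k <;> push_cast at hk <;> rcases hk with hk | hk
    · left; linarith
    · left; linarith
    · right; right; left; linarith
    · right; left; linarith
    · right; right; right; linarith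
    · right; right; right; linarith
  · rintro (rfl | rfl | rfl | rfl)
    · exact ⟨⟨h0, by linarith⟩, rfl⟩
    · refine ⟨⟨by linarith, by linarith⟩, ?_⟩
      rw [mul_sub, cos_two_pi_sub]
    · refine ⟨⟨by linarith, by linarith⟩, ?_⟩
      rw [mul_add, add_comm, cos_add_two_pi]
    · refine ⟨⟨by linarith, by linarith⟩, ?_⟩
      rw [show 2 * (2 * π - l) = 2 * π - 2 * l + 2 * π by ring, cos_add_two_pi, cos_two_pi_sub]

/-- The equation `p(φ) + p''(φ) = r` has a solution iff `b²/a ≤ r ≤ a²/b`; in that case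
`λ` is a solution, and the solutions in `[0, 2π]` are exactly `λ, π−λ, π+λ, 2π−λ`. -/
theorem cusps_of_inner_parallel_curve (a b r : ℝ) (hb : 0 < b) (hba : b < a) (hr : 0 < r) :
    ((∃ φ : ℝ, psup a b φ + deriv (deriv (psup a b)) φ = r) ↔ (b^2/a ≤ r ∧ r ≤ a^2/b)) ∧
    (b^2/a ≤ r → r ≤ a^2/b →
      psup a b (lamAng a b r) + deriv (deriv (psup a b)) (lamAng a b r) = r ∧
      {φ ∈ Icc (0:ℝ) (2*π) | psup a b φ + deriv (deriv (psup a b)) φ = r}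
        = {lamAng a b r, π - lamAng a b r, π + lamAng a b r, 2*π - lamAng a b r}) := by
  simp only [psup_add_deriv_deriv_eq_iff hb hba hr, ← cos_two_mul_cusp_mem_Icc_iff hb hba hr]
  have hmem := cos_two_mul_cusp_mem_Icc_iff hb hba hr
  set c := (2 * (a ^ 2 * b ^ 2 / r) ^ ((2 : ℝ) / 3) - a ^ 2 - b ^ 2) / (a ^ 2 - b ^ 2) with hc
  have hl : 2 * lamAng a b r = arccos c := by
    rw [lamAng, ← hc]
    ring
  have hcos : c ∈ Icc (-1 : ℝ) 1 → cos (2 * lamAng a b r) = c := fun h => by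
    rw [hl, cos_arccos h.1 h.2]
  refine ⟨⟨?_, fun h => ⟨_, hcos h⟩⟩, fun h1 h2 => ?_⟩
  · rintro ⟨φ, hφ⟩
    exact hφ ▸ cos_mem_Icc _
  · have h := hcos (hmem.2 ⟨h1, h2⟩)
    refine ⟨h, ?_⟩
    rw [← setOf_cos_two_mul_eq (by linarith [arccos_nonneg c]) (by linarith [arccos_le_pi c]), h]
end
end
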